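/- If Q is an orientation of a Dynkin diagram, then the poset NC_Q of noncrossing partitions of the associated finite Coxeter group W with respect to the Coxeter element cox(Q), which is the interval [e, cox(Q)] in absolute order, is a lattice. -/

import Mathlib

open CategoryTheory CategoryTheory.Limits ZeroObject

attribute [local instance] CategoryTheory.Abelian.hasFiniteBiproducts

noncomputable section

namespace NCPaper

/-- A finite quiver without oriented cycles. -/
structure FinQuiver : Type 1 where
  V : Type
  [quiver : Quiver.{0} V]
  [fintypeV : Fintype V]
  [fintypeArr : ∀ a b : V, Fintype (a ⟶ b)]
  acyclic : ∀ (v : V) (p : Quiver.Path v v), p = Quiver.Path.nil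

attribute [instance] FinQuiver.quiver FinQuiver.fintypeV FinQuiver.fintypeArr

variable (k : Type) [Field k] (Q : FinQuiver)

/-- The ambient abelian category of all `k`-linear representations of `Q`;
finite-dimensional representations are singled out by the predicate `FinDim`. -/
abbrev RepC : Type 1 := Paths Q.V ⥤ ModuleCat.{0} k

variable {k Q}

/-- `M` is a finite-dimensional representation, i.e. an object of `rep Q`. -/
def FinDim (M : RepC k Q) : Prop :=
  ∀ v : Q.V, FiniteDimensional k (M.obj ((Paths.of Q.V).obj v))

section Cat

variable {C : Type*} [Category C] [Abelian C]

/-- `X` is a direct summand of `A`. -/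
def IsSummand (X A : C) : Prop := ∃ (i : X ⟶ A) (r : A ⟶ X), i ≫ r = 𝟙 X

/-- The additive closure of a set of objects: direct summands of finite direct sums. -/
def addSet (S : Set C) : Set C :=
  { X | ∃ (n : ℕ) (f : Fin n → C), (∀ i, f i ∈ S) ∧ IsSummand X (⨁ f) }

/-- `Gen S`: all quotients of objects of the additive closure of `S`. -/
def gen (S : Set C) : Set C := { X | ∃ A ∈ addSet S, ∃ p : A ⟶ X, Epi p }

/-- All morphisms from `A` to `B` vanish. -/
def HomZero (A B : C) : Prop := ∀ f : A ⟶ B, f = 0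

/-- `Ext¹(A, B) = 0`, expressed by the splitting of all short exact sequences
`0 ⟶ B ⟶ E ⟶ A ⟶ 0`. -/
def Ext1Zero (A B : C) : Prop :=
  ∀ (E : C) (i : B ⟶ E) (p : E ⟶ A) (w : i ≫ p = 0),
    (ShortComplex.mk i p w).ShortExact → ∃ r : E ⟶ B, i ≫ r = 𝟙 B

/-- An indecomposable object. -/
def Indec (X : C) : Prop :=
  ¬ IsZero X ∧ ∀ (A B : C), (X ≅ A ⊞ B) → IsZero A ∨ IsZero B

/-- A torsion class: a full subcategory (identified with its set of objects) closed under
direct sums, direct summands, quotients and extensions. -/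
structure IsTorsionClass (T : Set C) : Prop where
  zero_mem : (0 : C) ∈ T
  sum_mem : ∀ X ∈ T, ∀ Y ∈ T, (X ⊞ Y : C) ∈ T
  summand_mem : ∀ X ∈ T, ∀ Y : C, IsSummand Y X → Y ∈ T
  quot_mem : ∀ X ∈ T, ∀ (Y : C) (p : X ⟶ Y), Epi p → Y ∈ T
  ext_mem : ∀ S : ShortComplex C, S.ShortExact → S.X₁ ∈ T → S.X₃ ∈ T → S.X₂ ∈ T

/-- A wide subcategory: a full subcategory (closed under direct sums and summands)
which is exact abelian (closed under kernels and cokernels) and closed under extensions. -/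
structure IsWide (A : Set C) : Prop where
  zero_mem : (0 : C) ∈ A
  sum_mem : ∀ X ∈ A, ∀ Y ∈ A, (X ⊞ Y : C) ∈ A
  summand_mem : ∀ X ∈ A, ∀ Y : C, IsSummand Y X → Y ∈ A
  ker_mem : ∀ X ∈ A, ∀ Y ∈ A, ∀ f : X ⟶ Y, (kernel f : C) ∈ A
  coker_mem : ∀ X ∈ A, ∀ Y ∈ A, ∀ f : X ⟶ Y, (cokernel f : C) ∈ A
  ext_mem : ∀ S : ShortComplex C, S.ShortExact → S.X₁ ∈ A → S.X₃ ∈ A → S.X₂ ∈ A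

/-- `P` is split projective in the subcategory `T`: every epimorphism onto `P`
from an object of `T` splits. -/
def SplitProjIn (T : Set C) (P : C) : Prop :=
  P ∈ T ∧ ∀ X ∈ T, ∀ p : X ⟶ P, Epi p → ∃ s : P ⟶ X, s ≫ p = 𝟙 P

/-- `P` is Ext-projective in the subcategory `T`. -/
def ExtProjIn (T : Set C) (P : C) : Prop := P ∈ T ∧ ∀ X ∈ T, Ext1Zero P X

/-- The subcategory `a(T)` associated to a torsion class `T`. -/
def aSet (T : Set C) : Set C :=
  { B | B ∈ T ∧ ∀ Y ∈ T, ∀ g : Y ⟶ B, (kernel g : C) ∈ T }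

/-- A subcategory is finitely generated if it is generated by a single object of it. -/
def IsFinGen (T : Set C) : Prop := ∃ U ∈ T, T ⊆ gen {U}

/-- `U` is a generator of the subcategory `T`. -/
def IsGenerator (T : Set C) (U : C) : Prop := U ∈ T ∧ T ⊆ gen {U}

/-- `X` is a subquotient of `M`. -/
def IsSubquotient (X M : C) : Prop := ∃ (N : C) (i : N ⟶ M) (p : N ⟶ X), Mono i ∧ Epi p

/-- The support of `M` is contained in the support of `C0`: every simple subquotient
(composition factor) of `M` is a composition factor of `C0`. -/
def SuppLE (M C0 : C) : Prop := ∀ S : C, Simple S → IsSubquotient S M → IsSubquotient S C0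

/-- A partial tilting object of a hereditary category. -/
def IsPartialTilting (T : C) : Prop := Ext1Zero T T

/-- `T` is a tilting object of the full subcategory `A`: it is self-orthogonal and every
(split) projective object of `A` admits a coresolution `0 ⟶ P ⟶ T' ⟶ T'' ⟶ 0` with
`T', T'' ∈ add T`. For `A` the subcategory of representations supported on `supp T`,
this says exactly that `T` is a tilting `kQ/ann T`-module. -/
def TiltingIn (A : Set C) (T : C) : Prop :=
  T ∈ A ∧ Ext1Zero T T ∧
    ∀ P : C, SplitProjIn A P →
      ∃ (T' T'' : C) (_ : T' ∈ addSet {T}) (_ : T'' ∈ addSet {T})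
        (i : P ⟶ T') (p : T' ⟶ T'') (w : i ≫ p = 0),
        (ShortComplex.mk i p w).ShortExact


/-- `U` is the direct sum of one representative of each isomorphism class of
indecomposable Ext-projective objects of `T`. -/
def IsExtProjSum (T : Set C) (U : C) : Prop :=
  ∃ (n : ℕ) (f : Fin n → C),
    (∀ i, Indec (f i) ∧ ExtProjIn T (f i)) ∧
    (∀ i j, Nonempty (f i ≅ f j) → i = j) ∧
    (∀ P : C, Indec P → ExtProjIn T P → ∃ i, Nonempty (P ≅ f i)) ∧
    Nonempty (U ≅ ⨁ f)

/-- A basic object: a direct sum of pairwise non-isomorphic indecomposables. -/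
def IsBasic (U : C) : Prop :=
  ∃ (n : ℕ) (f : Fin n → C), (∀ i, Indec (f i)) ∧
    (∀ i j, Nonempty (f i ≅ f j) → i = j) ∧ Nonempty (U ≅ ⨁ f)

end Cat

/-- A support tilting object of `rep Q`: partial tilting, and tilting as a
`kQ/ann T`-module, i.e. tilting in the subcategory of all finite-dimensional
representations supported on the support of `T`. -/
def IsSupportTilting {k : Type} [Field k] {Q : FinQuiver} (T : RepC k Q) : Prop :=
  IsPartialTilting T ∧ TiltingIn { M : RepC k Q | FinDim M ∧ SuppLE M T } T

section Comb

/-- The dimension vector of a representation. -/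
def dimVec {k : Type} [Field k] {Q : FinQuiver} (M : RepC k Q) : Q.V → ℤ :=
  fun v => (Module.finrank k (M.obj ((Paths.of Q.V).obj v)) : ℤ)

/-- The Euler form of the quiver `Q`. -/
def euler (Q : FinQuiver) {R : Type} [CommRing R] (α β : Q.V → R) : R :=
  (∑ v : Q.V, α v * β v) - ∑ a : (Σ x : Q.V, Σ y : Q.V, x ⟶ y), α a.1 * β a.2.1

/-- The symmetrized Euler form of the quiver `Q`. -/
def symEuler (Q : FinQuiver) {R : Type} [CommRing R] (α β : Q.V → R) : R :=
  euler Q α β + euler Q β α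

/-- The reflection in the vector `v`: `s_v(w) = w - (v, w)·v`. -/
def reflV (Q : FinQuiver) (v : Q.V → ℤ) : (Q.V → ℤ) → (Q.V → ℤ) :=
  fun w => w - symEuler Q v w • v

/-- The composition (product, written from left to right) of a finite sequence of
linear transformations. -/
def comps (Q : FinQuiver) {m : ℕ} (g : Fin m → ((Q.V → ℤ) → (Q.V → ℤ))) :
    (Q.V → ℤ) → (Q.V → ℤ) :=
  (List.ofFn g).foldr (· ∘ ·) id

open scoped Classical in
/-- The simple root at a vertex. -/
def simRoot (Q : FinQuiver) (v : Q.V) : Q.V → ℤ := fun w => if w = v then 1 else 0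

/-- The simple reflection at a vertex. -/
def sref (Q : FinQuiver) (v : Q.V) : (Q.V → ℤ) → (Q.V → ℤ) := reflV Q (simRoot Q v)

/-- An enumeration of the vertices is compatible with the arrows of `Q` if sources
of arrows come before targets. -/
def OrdCompatible (Q : FinQuiver) (ord : Fin (Fintype.card Q.V) ≃ Q.V) : Prop :=
  ∀ (x y : Q.V), (x ⟶ y) → ord.symm x < ord.symm y

/-- The Coxeter element `cox(Q)`: the product of the simple reflections from left to
right in an order compatible with the arrows of `Q`. -/
def coxeter (Q : FinQuiver) (ord : Fin (Fintype.card Q.V) ≃ Q.V) :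
    (Q.V → ℤ) → (Q.V → ℤ) :=
  comps Q fun i => sref Q (ord i)

/-- The product of the simple reflections indexed by a word (a list of vertices). -/
def wordProd (Q : FinQuiver) (l : List Q.V) : (Q.V → ℤ) → (Q.V → ℤ) :=
  (l.map (sref Q)).foldr (· ∘ ·) id

/-- Membership in the Coxeter group `W` (realized faithfully on the root lattice). -/
def InW (Q : FinQuiver) (w : (Q.V → ℤ) → (Q.V → ℤ)) : Prop :=
  ∃ l : List Q.V, w = wordProd Q l

/-- The reflections of `W`: the conjugates of the simple reflections. -/
def IsRefl (Q : FinQuiver) (t : (Q.V → ℤ) → (Q.V → ℤ)) : Prop :=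
  ∃ (l : List Q.V) (i : Q.V), t = wordProd Q l ∘ sref Q i ∘ wordProd Q l.reverse

/-- The absolute length: the least length of an expression as a product of reflections. -/
def ellT (Q : FinQuiver) (w : (Q.V → ℤ) → (Q.V → ℤ)) : ℕ :=
  sInf { m | ∃ f : Fin m → ((Q.V → ℤ) → (Q.V → ℤ)), (∀ i, IsRefl Q (f i)) ∧ w = comps Q f }

/-- The absolute order on `W`. -/
def absLe (Q : FinQuiver) : ((Q.V → ℤ) → (Q.V → ℤ)) → ((Q.V → ℤ) → (Q.V → ℤ)) → Prop :=
  Relation.ReflTransGen fun u v => ∃ t, IsRefl Q t ∧ v = u ∘ t ∧ ellT Q v = ellT Q u + 1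

/-- The noncrossing partitions `NC_Q`: the interval `[e, cox(Q)]` in absolute order. -/
def NCSet (Q : FinQuiver) (ord : Fin (Fintype.card Q.V) ≃ Q.V) :
    Set ((Q.V → ℤ) → (Q.V → ℤ)) :=
  { w | InW Q w ∧ absLe Q w (coxeter Q ord) }

/-- `Q` is of finite (Dynkin) type: the symmetrized Euler form is positive definite. -/
def FiniteType (Q : FinQuiver) : Prop :=
  ∀ α : Q.V → ℚ, α ≠ 0 → 0 < symEuler Q α α

/-- `Q` is of affine (extended Dynkin) type: the symmetrized Euler form is positive
semidefinite with nontrivial radical. -/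
def AffineType (Q : FinQuiver) : Prop :=
  (∀ α : Q.V → ℚ, 0 ≤ symEuler Q α α) ∧ ∃ α : Q.V → ℚ, α ≠ 0 ∧ symEuler Q α α = 0

end Comb

section AbstractNC

variable {V : Type*} [AddCommGroup V] [Module ℚ V]

/-- cone generated by a set -/
def ncCone (s : Set V) : AddSubmonoid V :=
  AddSubmonoid.closure {x | ∃ c : ℚ, 0 ≤ c ∧ ∃ a ∈ s, x = c • a}

theorem ncCone_smul_mem {s : Set V} {a : V} (ha : a ∈ s) {c : ℚ} (hc : 0 ≤ c) :
    c • a ∈ ncCone s := AddSubmonoid.subset_closure ⟨c, hc, a, ha, rfl⟩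

theorem ncCone_mem {s : Set V} {a : V} (ha : a ∈ s) : a ∈ ncCone s := by
  simpa using ncCone_smul_mem ha (zero_le_one)

theorem ncCone_smul {s : Set V} {x : V} (hx : x ∈ ncCone s) {c : ℚ} (hc : 0 ≤ c) :
    c • x ∈ ncCone s := by
  induction hx using AddSubmonoid.closure_induction with
  | mem x h =>
    obtain ⟨d, hd, a, ha, rfl⟩ := h
    rw [smul_smul]
    exact ncCone_smul_mem ha (mul_nonneg hc hd)
  | zero => simp
  | add x y _ _ hx hy => rw [smul_add]; exact add_mem hx hy

theorem ncCone_le {s t : Set V} (h : ∀ a ∈ s, a ∈ ncCone t) {x : V} (hx : x ∈ ncCone s) :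
    x ∈ ncCone t := by
  induction hx using AddSubmonoid.closure_induction with
  | mem x h' =>
    obtain ⟨d, hd, a, ha, rfl⟩ := h'
    exact ncCone_smul (h a ha) hd
  | zero => exact zero_mem _
  | add x y _ _ hx hy => exact add_mem hx hy

theorem ncCone_mono {s t : Set V} (h : s ⊆ t) {x : V} (hx : x ∈ ncCone s) : x ∈ ncCone t :=
  ncCone_le (fun _ ha => ncCone_mem (h ha)) hx

theorem ncCone_map {s t : Set V} (f : V →ₗ[ℚ] V) (h : ∀ a ∈ s, f a ∈ ncCone t) {x : V}
    (hx : x ∈ ncCone s) : f x ∈ ncCone t := by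
  induction hx using AddSubmonoid.closure_induction with
  | mem x h' =>
    obtain ⟨d, hd, a, ha, rfl⟩ := h'
    rw [map_smul]
    exact ncCone_smul (h a ha) hd
  | zero => simp
  | add x y _ _ hx hy => rw [map_add]; exact add_mem hx hy

theorem ncCone_nonneg {s : Set V} (f : V →ₗ[ℚ] ℚ) (h : ∀ a ∈ s, 0 ≤ f a) {x : V}
    (hx : x ∈ ncCone s) : 0 ≤ f x := by
  induction hx using AddSubmonoid.closure_induction with
  | mem x h' =>
    obtain ⟨d, hd, a, ha, rfl⟩ := h'
    rw [map_smul]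
    exact mul_nonneg hd (h a ha)
  | zero => simp
  | add x y _ _ hx hy => rw [map_add]; exact add_nonneg hx hy

theorem ncCone_nonpos {s : Set V} (f : V →ₗ[ℚ] ℚ) (h : ∀ a ∈ s, f a ≤ 0) {x : V}
    (hx : x ∈ ncCone s) : f x ≤ 0 := by
  have := ncCone_nonneg (-f) (fun a ha => by simpa using h a ha) hx
  simpa using this

theorem ncCone_span {s : Set V} {x : V} (hx : x ∈ ncCone s) : x ∈ Submodule.span ℚ s := by
  induction hx using AddSubmonoid.closure_induction with
  | mem x h' =>
    obtain ⟨d, hd, a, ha, rfl⟩ := h'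
    exact Submodule.smul_mem _ _ (Submodule.subset_span ha)
  | zero => simp
  | add x y _ _ hx hy => exact add_mem hx hy

theorem ncCone_split {s t : Set V} {b : V} (hs : ∀ a ∈ s, a = b ∨ a ∈ t) {x : V}
    (hx : x ∈ ncCone s) : ∃ c : ℚ, 0 ≤ c ∧ ∃ y ∈ ncCone t, x = c • b + y := by
  induction hx using AddSubmonoid.closure_induction with
  | mem x h' =>
    obtain ⟨d, hd, a, ha, rfl⟩ := h'
    rcases hs a ha with rfl | h
    · exact ⟨d, hd, 0, zero_mem _, by simp⟩
    · exact ⟨0, le_rfl, d • a, ncCone_smul_mem h hd, by simp⟩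
  | zero => exact ⟨0, le_rfl, 0, zero_mem _, by simp⟩
  | add x y _ _ hx hy =>
    obtain ⟨c, hc, u, hu, rfl⟩ := hx
    obtain ⟨d, hd, v, hv, rfl⟩ := hy
    exact ⟨c + d, add_nonneg hc hd, u + v, add_mem hu hv, by rw [add_smul]; abel⟩

variable (E : V →ₗ[ℚ] V →ₗ[ℚ] ℚ)

/-- the directedness relation -/
def NcR (a b : V) : Prop := 0 ≤ E a b ∧ E b a ≤ 0

/-- the reflection -/
def ncS (b : V) : V →ₗ[ℚ] V := LinearMap.id - (E b + E.flip b).smulRight b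

theorem ncS_apply (b x : V) : ncS E b x = x - (E b x + E x b) • b := by
  simp [ncS]

/-- the root data -/
structure NcRoot (R : Set V) : Prop where
  one : ∀ a ∈ R, E a a = 1
  refl : ∀ a ∈ R, ∀ b ∈ R, ncS E b a ∈ R

variable {E} {R : Set V}

theorem NcRoot.neg (hR : NcRoot E R) {a : V} (ha : a ∈ R) : -a ∈ R := by
  have := hR.refl a ha a ha
  rw [ncS_apply, hR.one a ha] at this
  convert this using 1
  module

variable (E R) in
/-- a directed list of half of the roots -/
structure NcDir (L : List V) : Prop where
  sub : ∀ a ∈ L, a ∈ R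
  all : ∀ a ∈ R, a ∈ L ∨ -a ∈ L
  pw : L.Pairwise (NcR E)

variable (E) in
/-- a simple system of the subspace `U` -/
structure NcSys (L : List V) (U : Submodule ℚ V) (D : Set V) : Prop where
  sub : ∀ a ∈ D, a ∈ L
  pw : ∀ a ∈ D, ∀ b ∈ D, a ≠ b → E a b ≤ 0
  span : Submodule.span ℚ D = U
  cone : ∀ a ∈ L, a ∈ U → a ∈ ncCone D

theorem NcDir.rot (hR : NcRoot E R) {b : V} {L : List V} (h : NcDir E R (b :: L)) :
    NcDir E R (L ++ [-b]) := by
  refine ⟨?_, ?_, ?_⟩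
  · intro a ha
    rcases List.mem_append.1 ha with h1 | h1
    · exact h.sub a (List.mem_cons_of_mem _ h1)
    · rw [List.mem_singleton.1 h1]
      exact hR.neg (h.sub b List.mem_cons_self)
  · intro a ha
    have := h.all a ha
    simp only [List.mem_cons, List.mem_append, List.not_mem_nil, or_false] at this ⊢
    rcases this with (h1 | h1) | (h1 | h1)
    · right; right; rw [h1]
    · left; left; exact h1
    · left; right; rw [← h1, neg_neg]
    · right; left; exact h1
  · have := h.pw
    rw [List.pairwise_cons] at this
    rw [List.pairwise_append]
    refine ⟨this.2, by simp, ?_⟩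
    intro a ha c hc
    rw [List.mem_singleton.1 hc]
    have := this.1 a ha
    simp only [NcR] at this ⊢
    simp only [map_neg, LinearMap.neg_apply]
    constructor <;> linarith [this.1, this.2]

theorem NcSys.mem {L : List V} {U : Submodule ℚ V} {D : Set V} (h : NcSys E L U D) {a : V}
    (ha : a ∈ D) : a ∈ U := by rw [← h.span]; exact Submodule.subset_span ha

theorem NcSys.first (hR : NcRoot E R) {b : V} {L : List V} (h : NcDir E R (b :: L))
    {U : Submodule ℚ V} {D : Set V} (hS : NcSys E (b :: L) U D) (hb : b ∈ U) : b ∈ D := by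
  by_contra hbD
  have h1 := hS.cone b List.mem_cons_self hb
  have h2 := ncCone_nonpos (E.flip b) (fun a ha => by
    have := hS.sub a ha
    rcases List.mem_cons.1 this with h3 | h3
    · exact absurd (h3 ▸ ha) hbD
    · exact ((List.pairwise_cons.1 h.pw).1 a h3).2) h1
  have := hR.one b (h.sub b List.mem_cons_self)
  simp only [LinearMap.flip_apply] at h2
  linarith

/-- projection along `b` to the left perpendicular of `b` -/
def ncPi (E : V →ₗ[ℚ] V →ₗ[ℚ] ℚ) (b : V) : V →ₗ[ℚ] V := LinearMap.id - (E.flip b).smulRight b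

theorem ncPi_apply (b x : V) : ncPi E b x = x - (E x b) • b := by
  simp [ncPi]

/-- basic facts about the first element -/
theorem NcSys.firstFacts (hR : NcRoot E R) {b : V} {L : List V} (h : NcDir E R (b :: L))
    {U : Submodule ℚ V} {D : Set V} (hS : NcSys E (b :: L) U D) (hb : b ∈ U) {a : V}
    (ha : a ∈ D) (hab : a ≠ b) : a ∈ L ∧ E b a = 0 ∧ E a b ≤ 0 ∧ ncPi E b a ∈ L
      ∧ E (ncPi E b a) b = 0 ∧ E b (ncPi E b a) = - E a b := by
  have hbD := hS.first hR h hb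
  have haL : a ∈ L := by
    rcases List.mem_cons.1 (hS.sub a ha) with h3 | h3
    · exact absurd h3 hab
    · exact h3
  have hbR := h.sub b List.mem_cons_self
  have hone := hR.one b hbR
  have hr := (List.pairwise_cons.1 h.pw).1 a haL
  have h0 : E b a = 0 := le_antisymm (hS.pw b hbD a ha (Ne.symm hab)) hr.1
  have e1 : E (ncPi E b a) b = 0 := by simp [ncPi_apply, hone]
  have e2 : E b (ncPi E b a) = - E a b := by simp [ncPi_apply, hone, h0]
  refine ⟨haL, h0, hr.2, ?_, e1, e2⟩
  have hin : ncPi E b a ∈ R := by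
    have := hR.refl a (h.sub a (List.mem_cons_of_mem _ haL)) b hbR
    rw [ncS_apply, h0, zero_add] at this
    rwa [ncPi_apply]
  rcases h.all _ hin with h1 | h1
  · rcases List.mem_cons.1 h1 with h2 | h2
    · rw [h2, hone] at e1; norm_num at e1
    · exact h2
  · rcases List.mem_cons.1 h1 with h2 | h2
    · have : ncPi E b a = - b := neg_eq_iff_eq_neg.1 h2
      rw [this] at e1; simp [hone] at e1
    · have := ((List.pairwise_cons.1 h.pw).1 _ h2).1
      rw [map_neg, e2] at this
      have h3 : E a b = 0 := by linarith [hr.2]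
      rw [ncPi_apply, h3, zero_smul, sub_zero]; exact haL

theorem NcSys.rot (hR : NcRoot E R) {b : V} {L : List V} (h : NcDir E R (b :: L))
    {U : Submodule ℚ V} {D : Set V} (hS : NcSys E (b :: L) U D) :
    ∃ D', NcSys E (L ++ [-b]) U D' ∧
      ∀ x ∈ ncCone D, (b ∈ U → E x b ≤ 0) → x ∈ ncCone D' := by
  by_cases hb : b ∈ U
  · have hbD := hS.first hR h hb
    have hone := hR.one b (h.sub b List.mem_cons_self)
    have F := fun a (ha : a ∈ D) hab => hS.firstFacts hR h hb (a := a) ha hab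
    have K : ∀ x ∈ ncCone D, (b ∈ U → E x b ≤ 0) →
        x ∈ ncCone (insert (-b) (ncPi E b '' (D \ {b}))) := by
      intro x h2 h4
      have h3 : ncPi E b x ∈ ncCone (insert (-b) (ncPi E b '' (D \ {b}))) := by
        refine ncCone_map (ncPi E b) ?_ h2
        intro c hc
        by_cases hcb : c = b
        · rw [hcb, ncPi_apply, hone]; simp
        · exact ncCone_mem (Or.inr ⟨c, ⟨hc, hcb⟩, rfl⟩)
      have h5 : x = ncPi E b x + (- E x b) • (-b) := by rw [ncPi_apply]; module
      rw [h5]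
      exact add_mem h3 (ncCone_smul_mem (Set.mem_insert _ _) (by linarith [h4 hb]))
    refine ⟨insert (-b) (ncPi E b '' (D \ {b})), ⟨?_, ?_, ?_, ?_⟩, K⟩
    · rintro a (rfl | ⟨a, ⟨ha, hab⟩, rfl⟩)
      · simp
      · exact List.mem_append_left _ (F a ha hab).2.2.2.1
    · rintro a (rfl | ⟨a, ⟨ha, hab⟩, rfl⟩) c (rfl | ⟨c, ⟨hc, hcb⟩, rfl⟩) hac
      · exact absurd rfl hac
      · simp only [map_neg, LinearMap.neg_apply]
        rw [(F c hc hcb).2.2.2.2.2]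
        linarith [(F c hc hcb).2.2.1]
      · simp only [map_neg]
        rw [(F a ha hab).2.2.2.2.1]; simp
      · have hne : a ≠ c := fun h => hac (by rw [h])
        rw [ncPi_apply b c, map_sub, map_smul, (F a ha hab).2.2.2.2.1, smul_zero, sub_zero,
          ncPi_apply, map_sub, map_smul, LinearMap.sub_apply, LinearMap.smul_apply,
          (F c hc hcb).2.1, smul_zero, sub_zero]
        exact hS.pw a ha c hc hne
    · apply le_antisymm
      · rw [Submodule.span_le]
        rintro a (rfl | ⟨a, ⟨ha, hab⟩, rfl⟩)
        · exact U.neg_mem hb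
        · rw [ncPi_apply]
          exact U.sub_mem (hS.mem ha) (U.smul_mem _ hb)
      · rw [← hS.span, Submodule.span_le]
        intro a ha
        have hb' : b ∈ Submodule.span ℚ (insert (-b) (ncPi E b '' (D \ {b}))) := by
          have := Submodule.subset_span (R := ℚ) (Set.mem_insert (-b) (ncPi E b '' (D \ {b})))
          simpa using Submodule.neg_mem _ this
        by_cases hab : a = b
        · rw [hab]; exact hb'
        · have h1 : ncPi E b a ∈ Submodule.span ℚ (insert (-b) (ncPi E b '' (D \ {b}))) :=
            Submodule.subset_span (Or.inr ⟨a, ⟨ha, hab⟩, rfl⟩)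
          have h2 : a = ncPi E b a + (E a b) • b := by rw [ncPi_apply]; abel
          rw [h2]
          exact Submodule.add_mem _ h1 (Submodule.smul_mem _ _ hb')
    · intro a ha haU
      rcases List.mem_append.1 ha with h1 | h1
      · have h2 := hS.cone a (List.mem_cons_of_mem _ h1) haU
        exact K a h2 (fun _ => ((List.pairwise_cons.1 h.pw).1 _ h1).2)
      · rw [List.mem_singleton.1 h1]
        exact ncCone_mem (Set.mem_insert _ _)
  · have hsub : ∀ a ∈ D, a ∈ L := by
      intro a ha
      rcases List.mem_cons.1 (hS.sub a ha) with h1 | h1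
      · exact absurd (h1 ▸ hS.mem ha) hb
      · exact h1
    refine ⟨D, ⟨fun a ha => List.mem_append_left _ (hsub a ha), hS.pw, hS.span, ?_⟩,
      fun x hx _ => hx⟩
    intro a ha haU
    rcases List.mem_append.1 ha with h1 | h1
    · exact hS.cone a (List.mem_cons_of_mem _ h1) haU
    · rw [List.mem_singleton.1 h1] at haU
      exact absurd (by simpa using U.neg_mem haU) hb

theorem NcSys.rotN (hR : NcRoot E R) {U : Submodule ℚ V} (A : List V) :
    ∀ (B : List V) (D : Set V), NcDir E R (A ++ B) → NcSys E (A ++ B) U D →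
      NcDir E R (B ++ A.map Neg.neg) ∧ ∃ D', NcSys E (B ++ A.map Neg.neg) U D' := by
  induction A with
  | nil => intro B D h1 h2; simpa using ⟨h1, D, h2⟩
  | cons a A ih =>
    intro B D h1 h2
    obtain ⟨D', h3, -⟩ := NcSys.rot hR (L := A ++ B) h1 h2
    have h4 := NcDir.rot hR (L := A ++ B) h1
    rw [List.append_assoc] at h3 h4
    have := ih _ _ h4 h3
    simpa using this

theorem NcSys.neg {U : Submodule ℚ V} {L : List V} {D : Set V}
    (h : NcSys E (L.map Neg.neg) U D) : NcSys E L U (Neg.neg '' D) := by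
  refine ⟨?_, ?_, ?_, ?_⟩
  · rintro _ ⟨a, ha, rfl⟩
    obtain ⟨c, hc, hca⟩ := List.mem_map.1 (h.sub a ha)
    rw [← hca]; simpa using hc
  · rintro _ ⟨a, ha, rfl⟩ _ ⟨b, hb, rfl⟩ hab
    simp only [map_neg, LinearMap.neg_apply, neg_neg]
    exact h.pw a ha b hb (fun h => hab (by rw [h]))
  · have : (Neg.neg '' D : Set V) = -D := by simp
    rw [this, Submodule.span_neg]; exact h.span
  · intro a ha haU
    have := h.cone (-a) (List.mem_map.2 ⟨a, ha, rfl⟩) (U.neg_mem haU)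
    have := ncCone_map (t := Neg.neg '' D) (-LinearMap.id) (fun c hc => by
      simpa using ncCone_mem (s := Neg.neg '' D) ⟨c, hc, rfl⟩) this
    simpa using this

variable (E) in
/-- the subspace has a simple system -/
def NcG (L : List V) (U : Submodule ℚ V) : Prop := ∃ D, NcSys E L U D

theorem NcG.perp (hR : NcRoot E R) {L : List V} (hL : NcDir E R L) {U : Submodule ℚ V}
    (hG : NcG E L U) {g : V} (hg : g ∈ L) (hgU : g ∈ U) :
    NcG E L (U ⊓ LinearMap.ker (E g)) := by
  obtain ⟨D, hS⟩ := hG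
  obtain ⟨A, B, rfl⟩ := List.append_of_mem hg
  obtain ⟨hd, D1, hS1⟩ := hS.rotN hR A (g :: B) D hL
  rw [List.cons_append] at hd hS1
  have hone := hR.one g (hL.sub g hg)
  have hgD := hS1.first hR hd hgU
  have F := fun a (ha : a ∈ D1) hab => hS1.firstFacts hR hd hgU (a := a) ha hab
  have hfix : ∀ {x : V}, x ∈ ncCone D1 → E g x = 0 → x ∈ ncCone (D1 \ {g}) := by
    intro x hx hx0
    have := ncCone_map (t := D1 \ {g}) (LinearMap.id - (E g).smulRight g) (fun c hc => by
      by_cases hcg : c = g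
      · simp [hcg, hone]
      · simpa [(F c hc hcg).2.1] using ncCone_mem (s := D1 \ {g}) ⟨hc, hcg⟩) hx
    simpa [hx0] using this
  have hS2 : NcSys E (g :: (B ++ A.map Neg.neg)) (U ⊓ LinearMap.ker (E g)) (D1 \ {g}) := by
    refine ⟨fun a ha => hS1.sub a ha.1, fun a ha b hb => hS1.pw a ha.1 b hb.1, ?_, ?_⟩
    · apply le_antisymm
      · rw [Submodule.span_le]
        intro a ha
        exact ⟨hS1.mem ha.1, (F a ha.1 ha.2).2.1⟩
      · rintro x ⟨hxU, hx0⟩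
        have hx0 : E g x = 0 := hx0
        have hxU : x ∈ U := hxU
        rw [← hS1.span] at hxU
        have : ∀ y ∈ Submodule.span ℚ D1, y - (E g y) • g ∈ Submodule.span ℚ (D1 \ {g}) := by
          intro y hy
          induction hy using Submodule.span_induction with
          | mem c hc =>
            by_cases hcg : c = g
            · simp [hcg, hone]
            · simpa [(F c hc hcg).2.1] using
                Submodule.subset_span (R := ℚ) (s := D1 \ {g}) ⟨hc, hcg⟩
          | zero => simp
          | add x y _ _ hx hy =>
            have := add_mem hx hy
            convert this using 1
            rw [map_add]; module
          | smul c x _ hx =>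
            have := Submodule.smul_mem _ c hx
            convert this using 1
            rw [map_smul, smul_eq_mul]; module
        simpa [hx0] using this x hxU
    · intro a ha haU
      exact hfix (hS1.cone a ha haU.1) haU.2
  have hd' : NcDir E R ((g :: B) ++ A.map Neg.neg) := hd
  have hS2' : NcSys E ((g :: B) ++ A.map Neg.neg) (U ⊓ LinearMap.ker (E g)) (D1 \ {g}) := hS2
  obtain ⟨-, D3, hS3⟩ := hS2'.rotN hR (g :: B) _ _ hd'
  rw [← List.map_append] at hS3
  exact ⟨_, hS3.neg⟩

/-- left perpendicular of the first element -/
theorem NcSys.leftPerp (hR : NcRoot E R) {b : V} {L : List V} (h : NcDir E R (b :: L))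
    {U : Submodule ℚ V} {D : Set V} (hS : NcSys E (b :: L) U D) (hb : b ∈ U) :
    NcSys E (b :: L) (U ⊓ LinearMap.ker (E.flip b)) (ncPi E b '' (D \ {b})) := by
  have hone := hR.one b (h.sub b List.mem_cons_self)
  have F := fun a (ha : a ∈ D) hab => hS.firstFacts hR h hb (a := a) ha hab
  refine ⟨?_, ?_, ?_, ?_⟩
  · rintro _ ⟨a, ⟨ha, hab⟩, rfl⟩
    exact List.mem_cons_of_mem _ (F a ha hab).2.2.2.1
  · rintro _ ⟨a, ⟨ha, hab⟩, rfl⟩ _ ⟨c, ⟨hc, hcb⟩, rfl⟩ hac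
    have hne : a ≠ c := fun h => hac (by rw [h])
    rw [ncPi_apply b c, map_sub, map_smul, (F a ha hab).2.2.2.2.1, smul_zero, sub_zero,
      ncPi_apply, map_sub, map_smul, LinearMap.sub_apply, LinearMap.smul_apply,
      (F c hc hcb).2.1, smul_zero, sub_zero]
    exact hS.pw a ha c hc hne
  · apply le_antisymm
    · rw [Submodule.span_le]
      rintro _ ⟨a, ⟨ha, hab⟩, rfl⟩
      refine ⟨?_, (F a ha hab).2.2.2.2.1⟩
      rw [ncPi_apply]
      exact U.sub_mem (hS.mem ha) (U.smul_mem _ hb)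
    · rintro x ⟨hxU, hx0⟩
      have hx0 : E x b = 0 := hx0
      have hxU : x ∈ U := hxU
      rw [← hS.span] at hxU
      have h1 : ncPi E b x ∈ (Submodule.span ℚ D).map (ncPi E b) := ⟨x, hxU, rfl⟩
      rw [Submodule.map_span] at h1
      have h2 : ncPi E b x = x := by simp [ncPi_apply, hx0]
      rw [h2] at h1
      refine Submodule.span_le.2 ?_ h1
      rintro _ ⟨a, ha, rfl⟩
      by_cases hab : a = b
      · simp [hab, ncPi_apply, hone]
      · exact Submodule.subset_span ⟨a, ⟨ha, hab⟩, rfl⟩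
  · rintro a ha ⟨haU, ha0⟩
    have ha0 : E a b = 0 := ha0
    have h2 : ncPi E b a = a := by simp [ncPi_apply, ha0]
    rw [← h2]
    refine ncCone_map (ncPi E b) ?_ (hS.cone a ha haU)
    intro c hc
    by_cases hcb : c = b
    · rw [hcb, ncPi_apply, hone]; simp
    · exact ncCone_mem ⟨c, ⟨hc, hcb⟩, rfl⟩

theorem nc_pointed {L : List V} (h1 : ∀ a ∈ L, E a a = 1)
    (h : L.Pairwise (fun a b => 0 ≤ E a b)) :
    ∀ x, x ∈ ncCone {a | a ∈ L} → -x ∈ ncCone {a | a ∈ L} → x = 0 := by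
  induction L with
  | nil =>
    intro x hx _
    have := ncCone_span hx
    simpa using this
  | cons b L ih =>
    intro x hx hx'
    rw [List.pairwise_cons] at h
    have hs : ∀ a ∈ {a | a ∈ b :: L}, a = b ∨ a ∈ {a | a ∈ L} := by
      intro a ha; simpa using ha
    obtain ⟨c, hc, y, hy, hxy⟩ := ncCone_split hs hx
    obtain ⟨d, hd, z, hz, hxz⟩ := ncCone_split hs hx'
    have h3 := ncCone_nonneg (E b) (fun a ha => h.1 a ha) hy
    have h4 := ncCone_nonneg (E b) (fun a ha => h.1 a ha) hz
    have h5 : E b x = c + E b y := by rw [hxy]; simp [h1 b]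
    have h6 : - E b x = d + E b z := by rw [← map_neg, hxz]; simp [h1 b]
    have hc0 : c = 0 := by linarith
    have hd0 : d = 0 := by linarith
    refine ih (fun a ha => h1 a (List.mem_cons_of_mem _ ha)) h.2 x ?_ ?_
    · rw [hxy, hc0]; simpa using hy
    · rw [hxz, hd0]; simpa using hz


variable (E) in
/-- compatible decomposition -/
structure NcDec (L : List V) (c : V → ℚ) (x : V) : Prop where
  eq : x = (L.map (fun a => c a • a)).sum
  nonneg : ∀ a ∈ L, 0 ≤ c a
  pw : L.Pairwise (fun a b => c a ≠ 0 → c b ≠ 0 → E b a = 0)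

theorem nc_sum_zero (f : V →ₗ[ℚ] ℚ) (c : V → ℚ) (L : List V) (h : ∀ a ∈ L, c a ≠ 0 → f a = 0) :
    f (L.map (fun a => c a • a)).sum = 0 := by
  induction L with
  | nil => simp
  | cons b L ih =>
    rw [List.map_cons, List.sum_cons, map_add, map_smul,
      ih (fun a ha => h a (List.mem_cons_of_mem _ ha)), add_zero, smul_eq_mul]
    by_cases hb : c b = 0
    · rw [hb, zero_mul]
    · rw [h b List.mem_cons_self hb, mul_zero]

theorem nc_sum_nonpos (f : V →ₗ[ℚ] ℚ) (c : V → ℚ) (L : List V) (h0 : ∀ a ∈ L, 0 ≤ c a)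
    (h : ∀ a ∈ L, f a ≤ 0) :
    f (L.map (fun a => c a • a)).sum ≤ 0 := by
  induction L with
  | nil => simp
  | cons b L ih =>
    rw [List.map_cons, List.sum_cons, map_add, map_smul, smul_eq_mul]
    have h1 := ih (fun a ha => h0 a (List.mem_cons_of_mem _ ha))
      (fun a ha => h a (List.mem_cons_of_mem _ ha))
    have h2 := mul_nonpos_of_nonneg_of_nonpos (h0 b List.mem_cons_self) (h b List.mem_cons_self)
    linarith

theorem nc_unique {L : List V} (h1 : ∀ a ∈ L, E a a = 1) (h : L.Pairwise (NcR E))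
    {c c' : V → ℚ} {x : V} (hc : NcDec E L c x) (hc' : NcDec E L c' x) : ∀ a ∈ L, c a = c' a := by
  induction L generalizing x with
  | nil => simp
  | cons b L ih =>
    rw [List.pairwise_cons] at h
    have key : ∀ {c : V → ℚ}, NcDec E (b :: L) c x → c b = max (E x b) 0 := by
      intro c hc
      have h2 := (List.pairwise_cons.1 hc.pw).1
      have h3 : E x b = c b + E.flip b (L.map (fun a => c a • a)).sum := by
        conv_lhs => rw [hc.eq]
        simp [h1 b]
      have h4 := nc_sum_nonpos (E.flip b) c L
        (fun a ha => hc.nonneg a (List.mem_cons_of_mem _ ha)) (fun a ha => (h.1 a ha).2)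
      have h5 := hc.nonneg b List.mem_cons_self
      by_cases hb : c b = 0
      · rw [hb] at h3 ⊢
        rw [max_eq_right]; linarith
      · rw [nc_sum_zero (E.flip b) c L (fun a ha hca => h2 a ha hb hca), add_zero] at h3
        rw [h3, max_eq_left h5]
    have hb : c b = c' b := by rw [key hc, key hc']
    have tail : ∀ {c : V → ℚ}, NcDec E (b :: L) c x → NcDec E L c (x - c b • b) := by
      intro c hc
      refine ⟨?_, fun a ha => hc.nonneg a (List.mem_cons_of_mem _ ha),
        (List.pairwise_cons.1 hc.pw).2⟩
      conv_lhs => rw [hc.eq]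
      simp
    intro a ha
    rcases List.mem_cons.1 ha with rfl | ha
    · exact hb
    · refine ih (fun a ha => h1 a (List.mem_cons_of_mem _ ha)) h.2 (tail hc) ?_ a ha
      rw [hb]; exact tail hc'

theorem nc_cone_sys {L : List V} {U : Submodule ℚ V} {D : Set V} (hS : NcSys E L U D) {x : V}
    (hx : x ∈ ncCone D) : x ∈ ncCone {a | a ∈ L} := ncCone_mono (fun a ha => hS.sub a ha) hx

open scoped Classical in
theorem nc_exists [FiniteDimensional ℚ V] (hR : NcRoot E R) (d : ℕ) :
    ∀ (U : Submodule ℚ V), Module.finrank ℚ U = d → ∀ (L : List V) (D : Set V), NcDir E R L →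
    NcSys E L U D → ∀ x ∈ ncCone D, ∃ c, NcDec E L c x ∧ ∀ a ∈ L, c a ≠ 0 → a ∈ U := by
  induction d using Nat.strong_induction_on with
  | _ d IH =>
  intro U hU
  have inner : ∀ (B A : List V) (D : Set V), NcDir E R (B ++ A.map Neg.neg) →
      NcSys E (B ++ A.map Neg.neg) U D → ∀ x ∈ ncCone D, x ∈ ncCone {a | a ∈ A ++ B} →
      ∃ c, NcDec E (B ++ A.map Neg.neg) c x ∧ ∀ a ∈ B ++ A.map Neg.neg, c a ≠ 0 → a ∈ U := by
    intro B
    induction B with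
    | nil =>
      intro A D hL hS x hx hx0
      have hz : x = 0 := by
        refine nc_pointed (E := E) (L := A.map Neg.neg)
          (fun a ha => hR.one a (hL.sub a (by simpa using ha)))
          ?_ x ?_ ?_
        · have := hL.pw
          rw [List.nil_append] at this
          exact this.imp (fun h => h.1)
        · simpa using nc_cone_sys hS hx
        · have := ncCone_map (t := {a | a ∈ A.map Neg.neg}) (-LinearMap.id) (fun c hc => by
            refine ncCone_mem ?_
            simpa using hc) hx0
          simpa using this
      refine ⟨fun _ => 0, ⟨?_, by simp, ?_⟩, by simp⟩
      · rw [hz]; simp [Function.comp_def]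
      · exact List.pairwise_of_forall (by simp)
    | cons b B ih =>
      intro A D hL hS x hx hx0
      rw [List.cons_append] at hL hS ⊢
      have hone := hR.one b (hL.sub b List.mem_cons_self)
      have hp := List.pairwise_cons.1 hL.pw
      have hbL : b ∉ B ++ A.map Neg.neg := by
        intro hb
        have := (hp.1 b hb).2
        linarith
      by_cases hcase : b ∈ U ∧ 0 ≤ E x b
      · obtain ⟨hb, ht⟩ := hcase
        have hS' := hS.leftPerp hR hL hb
        have hx' : ncPi E b x ∈ ncCone (ncPi E b '' (D \ {b})) := by
          refine ncCone_map (ncPi E b) ?_ hx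
          intro c hc
          by_cases hcb : c = b
          · rw [hcb, ncPi_apply, hone]; simp
          · exact ncCone_mem ⟨c, ⟨hc, hcb⟩, rfl⟩
        have hlt : Module.finrank ℚ (U ⊓ LinearMap.ker (E.flip b) : Submodule ℚ V) < d := by
          rw [← hU]
          refine Submodule.finrank_lt_finrank_of_lt (lt_of_le_of_ne inf_le_left ?_)
          intro heq
          rw [← heq] at hb
          have : E b b = 0 := hb.2
          linarith
        obtain ⟨c, hc, hcU⟩ := IH _ hlt _ rfl _ _ hL hS' _ hx'
        have hcb : c b = 0 := by
          by_contra h0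
          have : E b b = 0 := (hcU b List.mem_cons_self h0).2
          linarith
        have hupd : ∀ a ∈ B ++ A.map Neg.neg, Function.update c b (E x b) a = c a := by
          intro a ha
          rw [Function.update_of_ne]
          rintro rfl; exact hbL ha
        refine ⟨Function.update c b (E x b), ⟨?_, ?_, ?_⟩, ?_⟩
        · rw [List.map_cons, List.sum_cons, Function.update_self,
            List.map_congr_left (fun a ha => by rw [hupd a ha])]
          have := hc.eq
          rw [List.map_cons, List.sum_cons, hcb, zero_smul, zero_add, ncPi_apply] at this
          rw [← this]; abel
        · intro a ha
          rcases List.mem_cons.1 ha with rfl | ha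
          · simpa using ht
          · rw [hupd a ha]; exact hc.nonneg a (List.mem_cons_of_mem _ ha)
        · rw [List.pairwise_cons]
          constructor
          · intro a ha _ hca
            rw [hupd a ha] at hca
            exact (hcU a (List.mem_cons_of_mem _ ha) hca).2
          · refine (List.pairwise_cons.1 hc.pw).2.imp_of_mem ?_
            intro a a' ha ha' h
            rw [hupd a ha, hupd a' ha']; exact h
        · intro a ha hca
          rcases List.mem_cons.1 ha with rfl | ha
          · exact hb
          · rw [hupd a ha] at hca
            exact (hcU a (List.mem_cons_of_mem _ ha) hca).1
      · obtain ⟨D', hS', hK⟩ := hS.rot hR hL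
        have hxD' : x ∈ ncCone D' := hK x hx (fun hb => by
          by_contra hcon
          exact hcase ⟨hb, by linarith⟩)
        have hL' := hL.rot hR
        have hlist : (B ++ A.map Neg.neg) ++ [-b] = B ++ (A ++ [b]).map Neg.neg := by simp
        rw [hlist] at hS' hL'
        obtain ⟨c, hc, hcU⟩ := ih (A ++ [b]) D' hL' hS' x hxD' (by simpa using hx0)
        rw [← hlist] at hc hcU
        have hEx : 0 ≤ E b x := by
          refine ncCone_nonneg (E b) ?_ (nc_cone_sys hS hx)
          intro a ha
          rcases List.mem_cons.1 ha with rfl | ha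
          · linarith
          · exact (hp.1 a ha).1
        have hpw := List.pairwise_append.1 hc.pw
        have heq := hc.eq
        rw [List.map_append, List.sum_append] at heq
        have hcb : c (-b) = 0 := by
          by_contra h0
          have h1 : E (-b) x = c (-b) := by
            rw [heq, map_add, nc_sum_zero (E (-b)) c _
              (fun a ha hca => hpw.2.2 a ha (-b) (by simp) hca h0)]
            simp [hone]
          have h2 := hc.nonneg (-b) (by simp)
          have h3 : 0 < c (-b) := lt_of_le_of_ne h2 (Ne.symm h0)
          rw [map_neg, LinearMap.neg_apply] at h1
          linarith
        have hupd : ∀ a ∈ B ++ A.map Neg.neg, Function.update c b 0 a = c a := by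
          intro a ha
          rw [Function.update_of_ne]
          rintro rfl; exact hbL ha
        refine ⟨Function.update c b 0, ⟨?_, ?_, ?_⟩, ?_⟩
        · rw [List.map_cons, List.sum_cons, Function.update_self,
            List.map_congr_left (fun a ha => by rw [hupd a ha]), zero_smul, zero_add]
          simpa [hcb] using heq
        · intro a ha
          rcases List.mem_cons.1 ha with rfl | ha
          · simp
          · rw [hupd a ha]; exact hc.nonneg a (List.mem_append_left _ ha)
        · rw [List.pairwise_cons]
          constructor
          · intro a ha h0
            simp at h0
          · refine hpw.1.imp_of_mem ?_
            intro a a' ha ha' h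
            rw [hupd a ha, hupd a' ha']; exact h
        · intro a ha hca
          rcases List.mem_cons.1 ha with rfl | ha
          · simp at hca
          · rw [hupd a ha] at hca
            exact hcU a (List.mem_append_left _ ha) hca
  intro L D hL hS x hx
  have := inner L [] D (by simpa using hL) (by simpa using hS) x hx (by
    simpa using nc_cone_sys hS hx)
  simpa using this

open scoped Classical in
theorem nc_meet [FiniteDimensional ℚ V] (hR : NcRoot E R) {L : List V} (hL : NcDir E R L)
    {U₁ U₂ : Submodule ℚ V} (h₁ : NcG E L U₁) (h₂ : NcG E L U₂) :
    ∃ S : List V, (∀ a ∈ S, a ∈ L) ∧ (∀ a ∈ S, a ∈ U₁ ∧ a ∈ U₂) ∧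
      S.Pairwise (fun a b => E b a = 0) ∧
      ∀ a ∈ L, a ∈ U₁ → a ∈ U₂ → a ∈ Submodule.span ℚ {b | b ∈ S} := by
  obtain ⟨D₁, hS₁⟩ := h₁
  obtain ⟨D₂, hS₂⟩ := h₂
  set M := L.filter (fun a => a ∈ U₁ ∧ a ∈ U₂) with hM
  have hMem : ∀ a, a ∈ M ↔ a ∈ L ∧ a ∈ U₁ ∧ a ∈ U₂ := by
    intro a; simp [hM]
  let X : ℕ → V := fun N => ∑ i : Fin M.length, ((N : ℚ) ^ (i : ℕ)) • M.get i
  have hX : ∀ N, X N ∈ ncCone {a | a ∈ M} := by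
    intro N
    refine sum_mem (fun i _ => ncCone_smul_mem (s := {a | a ∈ M}) (List.get_mem M i) ?_)
    positivity
  have hdec : ∀ N, ∃ c, NcDec E L c (X N) ∧ ∀ a ∈ L, c a ≠ 0 → a ∈ U₁ ∧ a ∈ U₂ := by
    intro N
    obtain ⟨c, hc, hcU⟩ := nc_exists hR _ U₁ rfl L D₁ hL hS₁ (X N)
      (ncCone_le (fun a ha => by
        have := (hMem a).1 ha
        exact hS₁.cone a this.1 this.2.1) (hX N))
    obtain ⟨c', hc', hcU'⟩ := nc_exists hR _ U₂ rfl L D₂ hL hS₂ (X N)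
      (ncCone_le (fun a ha => by
        have := (hMem a).1 ha
        exact hS₂.cone a this.1 this.2.2) (hX N))
    have := nc_unique (fun a ha => hR.one a (hL.sub a ha)) hL.pw hc hc'
    refine ⟨c, hc, fun a ha h0 => ⟨hcU a ha h0, hcU' a ha ?_⟩⟩
    rw [← this a ha]; exact h0
  choose c hc hcU using hdec
  let S : ℕ → Finset V := fun N => L.toFinset.filter (fun a => c N a ≠ 0)
  obtain ⟨T, hT⟩ : ∃ T, {N | S N = T}.Infinite := by
    by_contra hcon
    push Not at hcon
    have hfin : (Set.univ : Set ℕ).Finite := by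
      refine Set.Finite.subset ((L.toFinset.powerset).finite_toSet.biUnion
        (fun T _ => hcon T)) ?_
      intro N _
      simp only [Set.mem_iUnion]
      exact ⟨S N, by simp +contextual [S, Finset.subset_iff], rfl⟩
    exact Set.infinite_univ hfin
  obtain ⟨N₀, hN₀⟩ := hT.nonempty
  have hN₀ : S N₀ = T := hN₀
  refine ⟨L.filter (fun a => c N₀ a ≠ 0), ?_, ?_, ?_, ?_⟩
  · intro a ha; exact (List.mem_filter.1 ha).1
  · intro a ha
    have := List.mem_filter.1 ha
    exact hcU N₀ a this.1 (by simpa using this.2)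
  · have h1 := (hc N₀).pw.sublist (List.filter_sublist (p := fun a => decide (c N₀ a ≠ 0)))
    refine h1.imp_of_mem ?_
    intro a b ha hb h
    exact h (by simpa using (List.mem_filter.1 ha).2) (by simpa using (List.mem_filter.1 hb).2)
  · intro a ha ha1 ha2
    have hset : {b | b ∈ L.filter (fun a => c N₀ a ≠ 0)} = (T : Set V) := by
      rw [← hN₀]; ext b; simp [S]
    rw [hset]
    by_contra hnot
    obtain ⟨f, hf, hfs⟩ := Submodule.exists_le_ker_of_notMem hnot
    have haM := (hMem a).2 ⟨ha, ha1, ha2⟩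
    obtain ⟨i, hi⟩ := List.get_of_mem haM
    let p : Polynomial ℚ := ∑ i : Fin M.length, Polynomial.monomial (i : ℕ) (f (M.get i))
    have hp0 : p ≠ 0 := by
      intro h0
      have : p.coeff i = f (M.get i) := by
        simp only [p, Polynomial.finsetSum_coeff, Polynomial.coeff_monomial]
        simp [Fin.val_inj]
      rw [h0, hi] at this
      exact hf (by simpa using this.symm)
    have hroot : ∀ N, S N = T → p.IsRoot (N : ℚ) := by
      intro N hN
      have h1 : f (X N) = 0 := by
        rw [(hc N).eq]
        refine nc_sum_zero f _ _ (fun b hb hcb => ?_)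
        have : b ∈ (T : Set V) := by rw [← hN]; simp [S, hb, hcb]
        exact hfs (Submodule.subset_span this)
      have h2 : f (X N) = p.eval (N : ℚ) := by
        simp only [X, p, map_sum, map_smul, Polynomial.eval_finsetSum, Polynomial.eval_monomial,
          smul_eq_mul]
        exact Finset.sum_congr rfl (fun _ _ => mul_comm _ _)
      rw [Polynomial.IsRoot, ← h2, h1]
    refine hT ((Set.Finite.preimage (f := fun n : ℕ => (n : ℚ)) (Nat.cast_injective.injOn)
      (p.roots.toFinset.finite_toSet)).subset ?_)
    intro N hN
    simp only [Set.mem_preimage, Finset.mem_coe, Multiset.mem_toFinset]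
    exact (Polynomial.mem_roots hp0).2 (hroot N hN)

theorem nc_rightPerp (hR : NcRoot E R) {L : List V} (hL : NcDir E R L) (T : List V) :
    ∀ U : Submodule ℚ V, NcG E L U → (∀ a ∈ T, a ∈ L ∧ a ∈ U) → T.Pairwise (fun a b => E a b = 0) →
    ¬ U ≤ Submodule.span ℚ {b | b ∈ T} → ∃ d ∈ L, d ∈ U ∧ ∀ a ∈ T, E a d = 0 := by
  induction T with
  | nil =>
    intro U hG _ _ hU
    obtain ⟨D, hS⟩ := hG
    have hne : D.Nonempty := by
      by_contra h0
      rw [Set.not_nonempty_iff_eq_empty] at h0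
      apply hU
      rw [← hS.span, h0]; simp
    obtain ⟨d, hd⟩ := hne
    exact ⟨d, hS.sub d hd, hS.mem hd, by simp⟩
  | cons b T ih =>
    intro U hG hT hp hU
    rw [List.pairwise_cons] at hp
    have hb := hT b List.mem_cons_self
    have hone := hR.one b (hL.sub b hb.1)
    obtain ⟨d, hd, hdU, hdT⟩ := ih (U ⊓ LinearMap.ker (E b)) (hG.perp hR hL hb.1 hb.2)
      (fun a ha => ⟨(hT a (List.mem_cons_of_mem _ ha)).1,
        (hT a (List.mem_cons_of_mem _ ha)).2, hp.1 a ha⟩) hp.2 (fun hle => by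
        apply hU
        intro x hx
        have h1 : x - (E b x) • b ∈ Submodule.span ℚ {b | b ∈ T} :=
          hle ⟨U.sub_mem hx (U.smul_mem _ hb.2), by simp [hone]⟩
        have h2 : x = (x - (E b x) • b) + (E b x) • b := by abel
        rw [h2]
        refine add_mem (Submodule.span_mono (fun a ha => List.mem_cons_of_mem _ ha) h1)
          (Submodule.smul_mem _ _ (Submodule.subset_span List.mem_cons_self)))
    refine ⟨d, hd, hdU.1, fun a ha => ?_⟩
    rcases List.mem_cons.1 ha with rfl | ha
    · exact hdU.2
    · exact hdT a ha


variable (E R) in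
/-- a state of the reflection process -/
structure NcSt (D : List V) : Prop where
  sub : ∀ a ∈ D, a ∈ R
  pw : D.Pairwise (fun a b => E a b = 0 ∧ E b a ≤ 0)
  sgn : ∀ a ∈ R, a ∈ ncCone {b | b ∈ D} ∨ -a ∈ ncCone {b | b ∈ D}

theorem ncS_ncS {b : V} (hb : E b b = 1) (x : V) : ncS E b (ncS E b x) = x := by
  simp only [ncS_apply, map_sub, map_smul, LinearMap.sub_apply, LinearMap.smul_apply, hb,
    smul_eq_mul]
  module

theorem NcSt.pointed (hR : NcRoot E R) {D : List V} (h : NcSt E R D) :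
    ∀ x, x ∈ ncCone {a | a ∈ D} → -x ∈ ncCone {a | a ∈ D} → x = 0 :=
  nc_pointed (fun a ha => hR.one a (h.sub a ha)) (h.pw.imp (fun h => h.1.ge))

theorem NcSt.refl_eq {b : V} {D : List V} (h : NcSt E R (b :: D)) {a : V} (ha : a ∈ D) :
    ncS E b a = ncPi E b a := by
  have := ((List.pairwise_cons.1 h.pw).1 a ha).1
  rw [ncS_apply, ncPi_apply, this, zero_add]

theorem NcSt.step (hR : NcRoot E R) {b : V} {D : List V} (h : NcSt E R (b :: D)) :
    NcSt E R (D.map (ncPi E b) ++ [-b]) := by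
  have hbR := h.sub b List.mem_cons_self
  have hone := hR.one b hbR
  have hp := List.pairwise_cons.1 h.pw
  refine ⟨?_, ?_, ?_⟩
  · intro a ha
    rcases List.mem_append.1 ha with h1 | h1
    · obtain ⟨c, hc, rfl⟩ := List.mem_map.1 h1
      rw [← h.refl_eq hc]
      exact hR.refl c (h.sub c (List.mem_cons_of_mem _ hc)) b hbR
    · rw [List.mem_singleton.1 h1]; exact hR.neg hbR
  · rw [List.pairwise_append]
    refine ⟨?_, by simp, ?_⟩
    · rw [List.pairwise_map]
      refine hp.2.imp_of_mem ?_
      intro a c ha hc hac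
      have h1 := (hp.1 a ha).1
      have h2 := (hp.1 c hc).1
      simp only [ncPi_apply, map_sub, map_smul, LinearMap.sub_apply, LinearMap.smul_apply,
        smul_eq_mul, hone, h1, h2]
      constructor
      · rw [hac.1]; ring
      · linarith [hac.2]
    · intro a ha c hc
      obtain ⟨a', ha', rfl⟩ := List.mem_map.1 ha
      rw [List.mem_singleton.1 hc]
      have h1 := (hp.1 a' ha')
      simp only [ncPi_apply, map_sub, map_smul, LinearMap.sub_apply, LinearMap.smul_apply,
        smul_eq_mul, hone, h1.1, map_neg, LinearMap.neg_apply]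
      constructor
      · ring
      · linarith [h1.2]
  · have key : ∀ x, x ∈ ncCone {c | c ∈ b :: D} →
        ncS E b x ∈ ncCone {c | c ∈ D.map (ncPi E b) ++ [-b]} := by
      intro x hx
      refine ncCone_map (ncS E b) ?_ hx
      intro a ha
      apply ncCone_mem
      rcases List.mem_cons.1 ha with rfl | ha
      · have : ncS E a a = -a := by rw [ncS_apply, hone]; module
        rw [this]; simp
      · rw [h.refl_eq ha]
        exact List.mem_append_left _ (List.mem_map.2 ⟨a, ha, rfl⟩)
    intro a ha
    rcases h.sgn _ (hR.refl a ha b hbR) with h1 | h1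
    · left
      have := key _ h1
      rwa [ncS_ncS hone] at this
    · right
      have := key _ h1
      rwa [map_neg, ncS_ncS hone] at this

theorem NcSt.turn (hR : NcRoot E R) {b : V} {D : List V} (h : NcSt E R (b :: D)) {r : V}
    (hr : r ∈ R) (hrD : r ∈ ncCone {c | c ∈ b :: D}) (hrb : r ≠ b) :
    r ∈ ncCone {c | c ∈ D.map (ncPi E b) ++ [-b]} := by
  have hbR := h.sub b List.mem_cons_self
  have hone := hR.one b hbR
  have hp := List.pairwise_cons.1 h.pw
  have hst := h.step hR
  rcases hst.sgn r hr with h1 | h1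
  · exact h1
  · exfalso
    have hs : ∀ a ∈ {a | a ∈ b :: D}, a = b ∨ a ∈ {a | a ∈ D} := by
      intro a ha; simpa using ha
    obtain ⟨d, hd, y, hy, hxy⟩ := ncCone_split (b := -b) (t := {a | a ∈ D.map (ncPi E b)})
      (fun a ha => by
        have : a ∈ D.map (ncPi E b) ++ [-b] := ha
        rcases List.mem_append.1 this with h1 | h1
        · exact Or.inr h1
        · exact Or.inl (List.mem_singleton.1 h1)) h1
    have hy' : y ∈ ncCone {c | c ∈ b :: D} := by
      refine ncCone_le ?_ hy
      intro a ha
      obtain ⟨a', ha', rfl⟩ := List.mem_map.1 ha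
      have : ncPi E b a' = a' + (-E a' b) • b := by rw [ncPi_apply]; module
      rw [this]
      exact add_mem (ncCone_mem (s := {c | c ∈ b :: D}) (List.mem_cons_of_mem _ ha'))
        (ncCone_smul_mem (s := {c | c ∈ b :: D}) List.mem_cons_self
          (by linarith [(hp.1 a' ha').2]))
    obtain ⟨c1, hc1, z1, hz1, e1⟩ := ncCone_split hs hrD
    obtain ⟨c2, hc2, z2, hz2, e2⟩ := ncCone_split hs hy'
    have hE : ∀ z ∈ ncCone {a | a ∈ D}, E b z = 0 := by
      intro z hz
      exact le_antisymm (ncCone_nonpos (E b) (fun a ha => (hp.1 a ha).1.le) hz)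
        (ncCone_nonneg (E b) (fun a ha => (hp.1 a ha).1.ge) hz)
    have e3 : z1 + z2 = (d - c1 - c2) • b := by
      have : -(c1 • b + z1) = d • -b + (c2 • b + z2) := by rw [← e1, ← e2, ← hxy]
      have h2 : z1 + z2 = -(-(c1 • b + z1)) - c1 • b + z2 := by abel
      rw [h2, this]; module
    have e4 : d - c1 - c2 = 0 := by
      have := congrArg (E b) e3
      rw [map_add, hE z1 hz1, hE z2 hz2, map_smul, hone] at this
      simpa using this.symm
    rw [e4, zero_smul] at e3
    have hz0 : z1 = 0 := by
      refine nc_pointed (E := E) (L := D)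
        (fun a ha => hR.one a (h.sub a (List.mem_cons_of_mem _ ha)))
        (hp.2.imp (fun h => h.1.ge)) z1 hz1 ?_
      rw [← eq_neg_of_add_eq_zero_right e3]; exact hz2
    rw [hz0, add_zero] at e1
    have h5 := hR.one r hr
    rw [e1] at h5
    simp only [map_smul, LinearMap.smul_apply, hone, smul_eq_mul, mul_one] at h5
    have : c1 = 1 := by nlinarith
    rw [this, one_smul] at e1
    exact hrb e1

open scoped Classical in
theorem nc_order (hR : NcRoot E R) (hfin : R.Finite) (n : ℕ) :
    ∀ K : Finset V, K.card = n → ∀ D : List V, NcSt E R D →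
    (∀ r ∈ K, r ∈ R ∧ r ∈ ncCone {c | c ∈ D}) →
    ∃ L : List V, (∀ a, a ∈ L ↔ a ∈ K) ∧ L.Pairwise (NcR E) := by
  induction n with
  | zero =>
    intro K hK D _ _
    rw [Finset.card_eq_zero] at hK
    exact ⟨[], by simp [hK], by simp⟩
  | succ n IH =>
    intro K hK
    obtain ⟨g, hg⟩ : K.Nonempty := by rw [← Finset.card_pos]; omega
    let cnt : List V → ℕ := fun D =>
      (hfin.toFinset.filter (fun r => r ∈ ncCone {c | c ∈ D} ∧ 0 < E r g)).card
    have fresh : ∀ D : List V, NcSt E R D → (∀ r ∈ K, r ∈ R ∧ r ∈ ncCone {c | c ∈ D}) →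
        ∃ i D1 a D2, D = D1 ++ a :: D2 ∧ D1.length = i ∧ E a g ≠ 0 := by
      intro D hD hKD
      have : ∃ a ∈ D, E a g ≠ 0 := by
        by_contra hcon
        push Not at hcon
        have h1 := ncCone_nonpos (E.flip g) (fun a ha => (hcon a ha).le) (hKD g hg).2
        have h2 := hR.one g (hKD g hg).1
        simp only [LinearMap.flip_apply] at h1
        linarith
      obtain ⟨a, ha, hne⟩ := this
      obtain ⟨D1, D2, rfl⟩ := List.append_of_mem ha
      exact ⟨_, D1, a, D2, rfl, rfl, hne⟩
    have stepL : ∀ (b : V) (D : List V), NcSt E R (b :: D) →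
        (∀ r ∈ K, r ∈ R ∧ r ∈ ncCone {c | c ∈ b :: D}) →
        (NcSt E R (D.map (ncPi E b) ++ [-b]) →
          (∀ r ∈ K, r ∈ R ∧ r ∈ ncCone {c | c ∈ D.map (ncPi E b) ++ [-b]}) →
          (E b g ≠ 0 → cnt (D.map (ncPi E b) ++ [-b]) < cnt (b :: D)) →
          cnt (D.map (ncPi E b) ++ [-b]) ≤ cnt (b :: D) →
          ∃ L : List V, (∀ a, a ∈ L ↔ a ∈ K) ∧ L.Pairwise (NcR E)) →
        ∃ L : List V, (∀ a, a ∈ L ↔ a ∈ K) ∧ L.Pairwise (NcR E) := by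
      intro b D hD hKD hcont
      have hst := hD.step hR
      have hbR := hD.sub b List.mem_cons_self
      have hone := hR.one b hbR
      have hp := List.pairwise_cons.1 hD.pw
      have hEb : ∀ x ∈ ncCone {c | c ∈ b :: D}, 0 ≤ E b x := by
        intro x hx
        refine ncCone_nonneg (E b) ?_ hx
        intro a ha
        rcases List.mem_cons.1 ha with rfl | ha
        · rw [hone]; exact zero_le_one
        · exact (hp.1 a ha).1.ge
      have hbcone : b ∈ ncCone {c | c ∈ b :: D} :=
        ncCone_mem (s := {c | c ∈ b :: D}) List.mem_cons_self
      have hnb : -b ∈ ncCone {c | c ∈ D.map (ncPi E b) ++ [-b]} :=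
        ncCone_mem (s := {c | c ∈ D.map (ncPi E b) ++ [-b]})
          (List.mem_append_right _ (List.mem_singleton.2 rfl))
      by_cases hbK : b ∈ K
      · have hK' : ∀ r ∈ K.erase b,
            r ∈ R ∧ r ∈ ncCone {c | c ∈ D.map (ncPi E b) ++ [-b]} := by
          intro r hr
          have h1 := Finset.mem_erase.1 hr
          have h2 := hKD r h1.2
          exact ⟨h2.1, hD.turn hR h2.1 h2.2 h1.1⟩
        obtain ⟨L, hL1, hL2⟩ := IH (K.erase b)
          (by rw [Finset.card_erase_of_mem hbK, hK]; rfl) _ hst hK'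
        refine ⟨b :: L, ?_, ?_⟩
        · intro a
          rw [List.mem_cons, hL1, Finset.mem_erase]
          by_cases hab : a = b
          · simp [hab, hbK]
          · simp [hab]
        · rw [List.pairwise_cons]
          refine ⟨?_, hL2⟩
          intro r hr
          have hr' := (hL1 r).1 hr
          refine ⟨hEb r (hKD r (Finset.mem_erase.1 hr').2).2, ?_⟩
          refine ncCone_nonpos (E.flip b) ?_ (hK' r hr').2
          intro a ha
          rw [LinearMap.flip_apply]
          rcases List.mem_append.1 ha with h1 | h1
          · obtain ⟨a', ha', rfl⟩ := List.mem_map.1 h1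
            rw [ncPi_apply, map_sub, map_smul, LinearMap.sub_apply, LinearMap.smul_apply, hone]
            simp
          · rw [List.mem_singleton.1 h1, map_neg, LinearMap.neg_apply, hone]
            norm_num
      · have hbg := hEb g (hKD g hg).2
        have hsub : (hfin.toFinset.filter (fun r =>
              r ∈ ncCone {c | c ∈ D.map (ncPi E b) ++ [-b]} ∧ 0 < E r g)) ⊆
            (hfin.toFinset.filter (fun r => r ∈ ncCone {c | c ∈ b :: D} ∧ 0 < E r g)) := by
          intro r hr
          rw [Finset.mem_filter, Set.Finite.mem_toFinset] at hr ⊢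
          refine ⟨hr.1, ?_, hr.2.2⟩
          rcases hD.sgn r hr.1 with h1 | h1
          · exact h1
          · exfalso
            by_cases hrb : -r = b
            · rw [← hrb, map_neg, LinearMap.neg_apply] at hbg
              linarith [hr.2.2]
            · have h2 := hD.turn hR (hR.neg hr.1) h1 hrb
              have h3 := hst.pointed hR r hr.2.1 h2
              have h4 := hR.one r hr.1
              rw [h3] at h4
              simp at h4
        refine hcont hst ?_ ?_ (Finset.card_le_card hsub)
        · intro r hr
          have h2 := hKD r hr
          exact ⟨h2.1, hD.turn hR h2.1 h2.2 (fun h => hbK (h ▸ hr))⟩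
        · intro hne
          apply Finset.card_lt_card
          refine ⟨hsub, fun hcon => ?_⟩
          have hb1 : b ∈ hfin.toFinset.filter
              (fun r => r ∈ ncCone {c | c ∈ b :: D} ∧ 0 < E r g) := by
            rw [Finset.mem_filter, Set.Finite.mem_toFinset]
            exact ⟨hbR, hbcone, lt_of_le_of_ne hbg (Ne.symm hne)⟩
          have hb2 := hcon hb1
          rw [Finset.mem_filter] at hb2
          have h3 := hst.pointed hR b hb2.2.1 hnb
          rw [h3] at hone
          simp at hone
    have main : ∀ m : ℕ, ∀ i : ℕ, ∀ D : List V, NcSt E R D →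
        (∀ r ∈ K, r ∈ R ∧ r ∈ ncCone {c | c ∈ D}) → cnt D = m →
        (∃ D1 a D2, D = D1 ++ a :: D2 ∧ D1.length = i ∧ E a g ≠ 0) →
        ∃ L : List V, (∀ a, a ∈ L ↔ a ∈ K) ∧ L.Pairwise (NcR E) := by
      intro m
      induction m using Nat.strong_induction_on with
      | _ m IHm =>
      have low : ∀ D : List V, NcSt E R D →
          (∀ r ∈ K, r ∈ R ∧ r ∈ ncCone {c | c ∈ D}) → cnt D < m →
          ∃ L : List V, (∀ a, a ∈ L ↔ a ∈ K) ∧ L.Pairwise (NcR E) := by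
        intro D h1 h2 h3
        obtain ⟨i, hi⟩ := fresh D h1 h2
        exact IHm _ h3 i D h1 h2 rfl hi
      intro i
      induction i with
      | zero =>
        rintro D hD hKD hm ⟨D1, b, D2, rfl, hlen, hne⟩
        rw [List.length_eq_zero_iff] at hlen
        subst hlen
        rw [List.nil_append] at hD hKD hm
        exact stepL b D2 hD hKD (fun h1 h2 h3 _ => low _ h1 h2 (by rw [← hm]; exact h3 hne))
      | succ i ihi =>
        rintro D hD hKD hm ⟨D1, a, D2, rfl, hlen, hne⟩
        obtain ⟨b, D1', rfl⟩ : ∃ b D1', D1 = b :: D1' := by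
          cases D1 with
          | nil => simp at hlen
          | cons b D1' => exact ⟨b, D1', rfl⟩
        rw [List.cons_append] at hD hKD hm
        refine stepL b _ hD hKD (fun h1 h2 h3 h4 => ?_)
        by_cases hlt : cnt (List.map (ncPi E b) (D1' ++ a :: D2) ++ [-b]) < m
        · exact low _ h1 h2 hlt
        · have hb0 : E b g = 0 := by
            by_contra hb0
            exact hlt (by rw [← hm]; exact h3 hb0)
          refine ihi _ h1 h2 (by omega) ⟨D1'.map (ncPi E b), ncPi E b a,
            D2.map (ncPi E b) ++ [-b], by simp, by simpa using hlen, ?_⟩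
          rw [ncPi_apply, map_sub, map_smul, LinearMap.sub_apply, LinearMap.smul_apply, hb0]
          simpa using hne
    intro D hD hKD
    obtain ⟨i, hi⟩ := fresh D hD hKD
    exact main _ i D hD hKD rfl hi

theorem nc_init (hR : NcRoot E R) (hfin : R.Finite) {D : List V} (hD : NcSt E R D)
    (hspan : Submodule.span ℚ {a | a ∈ D} = ⊤) :
    ∃ L : List V, NcDir E R L ∧ NcG E L ⊤ := by
  classical
  obtain ⟨L, h1, h2⟩ := nc_order hR hfin _
    (hfin.toFinset.filter (fun r => r ∈ ncCone {c | c ∈ D})) rfl D hD (by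
      intro r hr
      rw [Finset.mem_filter, Set.Finite.mem_toFinset] at hr
      exact hr)
  have h3 : ∀ a, a ∈ L ↔ a ∈ R ∧ a ∈ ncCone {c | c ∈ D} := by
    intro a
    rw [h1, Finset.mem_filter, Set.Finite.mem_toFinset]
  refine ⟨L, ⟨fun a ha => ((h3 a).1 ha).1, ?_, h2⟩, {a | a ∈ D}, ?_, ?_, hspan, ?_⟩
  · intro a ha
    rcases hD.sgn a ha with h4 | h4
    · exact Or.inl ((h3 a).2 ⟨ha, h4⟩)
    · exact Or.inr ((h3 _).2 ⟨hR.neg ha, h4⟩)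
  · intro a ha
    exact (h3 a).2 ⟨hD.sub a ha, ncCone_mem (s := {c | c ∈ D}) ha⟩
  · intro a ha b hb hab
    exact List.Pairwise.forall_of_forall_of_flip (R := fun a b => a ≠ b → E a b ≤ 0) (l := D)
      (fun x _ h => absurd rfl h) (hD.pw.imp (fun h _ => h.1.le))
      (hD.pw.imp (fun h _ => h.2)) ha hb hab
  · intro a ha _
    exact ((h3 a).1 ha).2

end AbstractNC



/-- the Euler form over the rationals -/
def qE (Q : FinQuiver) : (Q.V → ℚ) →ₗ[ℚ] (Q.V → ℚ) →ₗ[ℚ] ℚ :=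
  LinearMap.mk₂ ℚ (fun x y => euler Q x y)
    (fun x y z => by
      simp only [euler, Pi.add_apply, add_mul, Finset.sum_add_distrib]; ring)
    (fun c x y => by
      simp only [euler, Pi.smul_apply, smul_eq_mul, mul_assoc, ← Finset.mul_sum]; ring)
    (fun x y z => by
      simp only [euler, Pi.add_apply, mul_add, Finset.sum_add_distrib]; ring)
    (fun c x y => by
      simp only [euler, Pi.smul_apply, smul_eq_mul, mul_left_comm _ c, ← Finset.mul_sum]; ring)

theorem qE_apply (Q : FinQuiver) (x y : Q.V → ℚ) : qE Q x y = euler Q x y := rfl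

/-- the inclusion of the lattice -/
def iot (Q : FinQuiver) : (Q.V → ℤ) →+ (Q.V → ℚ) := (Int.castAddHom ℚ).compLeft Q.V

theorem iot_apply (Q : FinQuiver) (x : Q.V → ℤ) (v : Q.V) : iot Q x v = (x v : ℚ) := rfl

theorem iot_inj (Q : FinQuiver) : Function.Injective (iot Q) := by
  intro x y h
  funext v
  have := congrFun h v
  rw [iot_apply, iot_apply] at this
  exact_mod_cast this

theorem iot_zsmul (Q : FinQuiver) (c : ℤ) (x : Q.V → ℤ) :
    iot Q (c • x) = (c : ℚ) • iot Q x := by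
  funext v
  simp [iot_apply]

theorem qE_iot (Q : FinQuiver) (x y : Q.V → ℤ) :
    qE Q (iot Q x) (iot Q y) = ((euler Q x y : ℤ) : ℚ) := by
  rw [qE_apply]
  simp [euler, iot_apply]

theorem qS_iot (Q : FinQuiver) (x y : Q.V → ℤ) :
    qE Q (iot Q x) (iot Q y) + qE Q (iot Q y) (iot Q x) = ((symEuler Q x y : ℤ) : ℚ) := by
  rw [qE_iot, qE_iot, symEuler]; push_cast; rfl

theorem iot_reflV (Q : FinQuiver) (b x : Q.V → ℤ) :
    iot Q (reflV Q b x) = ncS (qE Q) (iot Q b) (iot Q x) := by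
  rw [reflV, map_sub, iot_zsmul, ncS_apply, qS_iot]

theorem qE_pos (Q : FinQuiver) (hft : FiniteType Q) (x : Q.V → ℚ) (hx : x ≠ 0) :
    0 < qE Q x x := by
  have := hft x hx
  rw [symEuler, ← qE_apply] at this
  linarith

theorem qE_eq_zero (Q : FinQuiver) (hft : FiniteType Q) (x : Q.V → ℚ) (hx : qE Q x x = 0) :
    x = 0 := by
  by_contra h
  exact (qE_pos Q hft x h).ne' hx

theorem wordProd_cons (Q : FinQuiver) (i : Q.V) (l : List Q.V) :
    wordProd Q (i :: l) = sref Q i ∘ wordProd Q l := rfl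

theorem wordProd_nil (Q : FinQuiver) : wordProd Q [] = id := rfl

theorem wordProd_append (Q : FinQuiver) (l l' : List Q.V) :
    wordProd Q (l ++ l') = wordProd Q l ∘ wordProd Q l' := by
  induction l with
  | nil => rfl
  | cons i l ih => rw [List.cons_append, wordProd_cons, ih, wordProd_cons]; rfl

/-- maps commuting with the lattice inclusion and isometric -/
structure QIso (Q : FinQuiver) (w : (Q.V → ℤ) → (Q.V → ℤ)) : Prop where
  lin : ∃ g : (Q.V → ℚ) →ₗ[ℚ] (Q.V → ℚ), ∀ x, iot Q (w x) = g (iot Q x)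
  iso : ∀ x y, symEuler Q (w x) (w y) = symEuler Q x y

theorem QIso.id (Q : FinQuiver) : QIso Q id := ⟨⟨LinearMap.id, fun _ => rfl⟩, fun _ _ => rfl⟩

theorem QIso.comp {Q : FinQuiver} {w w' : (Q.V → ℤ) → (Q.V → ℤ)} (h : QIso Q w)
    (h' : QIso Q w') : QIso Q (w ∘ w') := by
  obtain ⟨⟨g, hg⟩, h2⟩ := h
  obtain ⟨⟨g', hg'⟩, h2'⟩ := h'
  exact ⟨⟨g.comp g', fun x => by simp [hg, hg']⟩, fun x y => by simp [h2, h2']⟩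

theorem QIso.refl {Q : FinQuiver} {b : Q.V → ℤ} (hb : euler Q b b = 1) :
    QIso Q (reflV Q b) := by
  refine ⟨⟨ncS (qE Q) (iot Q b), iot_reflV Q b⟩, fun x y => ?_⟩
  have hb' : qE Q (iot Q b) (iot Q b) = 1 := by rw [qE_iot, hb]; simp
  have : ((symEuler Q (reflV Q b x) (reflV Q b y) : ℤ) : ℚ) = ((symEuler Q x y : ℤ) : ℚ) := by
    rw [← qS_iot, ← qS_iot, iot_reflV, iot_reflV, ncS_apply, ncS_apply]
    simp only [map_sub, map_smul, LinearMap.sub_apply, LinearMap.smul_apply, smul_eq_mul, hb']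
    ring
  exact_mod_cast this

theorem euler_self (Q : FinQuiver) (x : Q.V → ℤ) : symEuler Q x x = 2 * euler Q x x := by
  rw [symEuler]; ring

theorem QIso.euler {Q : FinQuiver} {w : (Q.V → ℤ) → (Q.V → ℤ)} (h : QIso Q w)
    (x : Q.V → ℤ) : NCPaper.euler Q (w x) (w x) = NCPaper.euler Q x x := by
  have := h.iso x x
  rw [euler_self, euler_self] at this
  linarith

theorem QIso.refl_conj {Q : FinQuiver} {w : (Q.V → ℤ) → (Q.V → ℤ)} (h : QIso Q w)
    (b x : Q.V → ℤ) : reflV Q (w b) (w x) = w (reflV Q b x) := by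
  apply iot_inj Q
  obtain ⟨⟨g, hg⟩, h2⟩ := h
  rw [hg, reflV, reflV, h2, map_sub, map_sub, iot_zsmul, iot_zsmul, map_sub, map_smul, hg, hg]

theorem reflV_reflV {Q : FinQuiver} {b : Q.V → ℤ} (hb : euler Q b b = 1) (x : Q.V → ℤ) :
    reflV Q b (reflV Q b x) = x := by
  apply iot_inj Q
  rw [iot_reflV, iot_reflV, ncS_ncS]
  rw [qE_iot, hb]; simp

theorem noLoop {Q : FinQuiver} {ord : Fin (Fintype.card Q.V) ≃ Q.V}
    (hord : OrdCompatible Q ord) (x : Q.V) (a : x ⟶ x) : False :=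
  lt_irrefl _ (hord x x a)

open scoped Classical in
theorem euler_sim {Q : FinQuiver} {ord : Fin (Fintype.card Q.V) ≃ Q.V}
    (hord : OrdCompatible Q ord) (i : Q.V) : euler Q (simRoot Q i) (simRoot Q i) = 1 := by
  rw [euler]
  have h1 : ∑ v : Q.V, simRoot Q i v * simRoot Q i v = 1 := by simp [simRoot]
  rw [h1, Finset.sum_eq_zero, sub_zero]
  rintro ⟨x, y, a⟩ _
  by_contra h
  simp only [simRoot, mul_ite, mul_one, mul_zero, ite_eq_right_iff, Classical.not_imp] at h
  obtain ⟨rfl, rfl, -⟩ := h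
  exact noLoop hord _ a

theorem euler_sim_ne {Q : FinQuiver} (i j : Q.V) (hij : i ≠ j) :
    euler Q (simRoot Q i) (simRoot Q j) ≤ 0 := by
  rw [euler]
  have h1 : ∑ v : Q.V, simRoot Q i v * simRoot Q j v = 0 := by
    apply Finset.sum_eq_zero
    intro v _
    by_cases h : v = i
    · subst h; simp [simRoot, hij]
    · simp [simRoot, h]
  rw [h1, zero_sub, neg_nonpos]
  apply Finset.sum_nonneg
  intro a _
  apply mul_nonneg <;> · rw [simRoot]; split_ifs <;> simp

theorem euler_sim_zero {Q : FinQuiver} (i j : Q.V) (hij : i ≠ j) (hno : IsEmpty (i ⟶ j)) :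
    euler Q (simRoot Q i) (simRoot Q j) = 0 := by
  rw [euler]
  have h1 : ∑ v : Q.V, simRoot Q i v * simRoot Q j v = 0 := by
    apply Finset.sum_eq_zero
    intro v _
    by_cases h : v = i
    · subst h; simp [simRoot, hij]
    · simp [simRoot, h]
  rw [h1, zero_sub, neg_eq_zero]
  apply Finset.sum_eq_zero
  rintro ⟨x, y, a⟩ _
  by_contra h
  simp only [simRoot, mul_ite, mul_one, mul_zero, ite_eq_right_iff, Classical.not_imp] at h
  obtain ⟨rfl, rfl, -⟩ := h
  exact hno.elim a

/-- the roots -/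
def qR (Q : FinQuiver) : Set (Q.V → ℚ) :=
  {a | ∃ (l : List Q.V) (i : Q.V), a = iot Q (wordProd Q l (simRoot Q i))}

section
variable {Q : FinQuiver} {ord : Fin (Fintype.card Q.V) ≃ Q.V}

theorem qiso_word (hord : OrdCompatible Q ord) (l : List Q.V) : QIso Q (wordProd Q l) := by
  induction l with
  | nil => exact QIso.id Q
  | cons i l ih => exact (QIso.refl (euler_sim hord i)).comp ih

theorem word_rev (hord : OrdCompatible Q ord) (l : List Q.V) (x : Q.V → ℤ) :
    wordProd Q l.reverse (wordProd Q l x) = x := by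
  induction l generalizing x with
  | nil => rfl
  | cons i l ih =>
    rw [List.reverse_cons, wordProd_append, wordProd_cons, wordProd_cons, wordProd_nil]
    simp only [Function.comp_apply, id]
    rw [sref, reflV_reflV (euler_sim hord i), ih]

theorem word_rev' (hord : OrdCompatible Q ord) (l : List Q.V) (x : Q.V → ℤ) :
    wordProd Q l (wordProd Q l.reverse x) = x := by
  have := word_rev hord l.reverse x
  rwa [List.reverse_reverse] at this

theorem refl_root (hord : OrdCompatible Q ord) (l : List Q.V) (i : Q.V) :
    reflV Q (wordProd Q l (simRoot Q i)) = wordProd Q l ∘ sref Q i ∘ wordProd Q l.reverse := by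
  funext x
  have := (qiso_word hord l).refl_conj (simRoot Q i) (wordProd Q l.reverse x)
  rw [word_rev' hord] at this
  exact this

theorem isRefl_iff (hord : OrdCompatible Q ord) (t : (Q.V → ℤ) → (Q.V → ℤ)) :
    IsRefl Q t ↔ ∃ b, iot Q b ∈ qR Q ∧ t = reflV Q b := by
  constructor
  · rintro ⟨l, i, rfl⟩
    exact ⟨_, ⟨l, i, rfl⟩, (refl_root hord l i).symm⟩
  · rintro ⟨b, ⟨l, i, hb⟩, rfl⟩
    exact ⟨l, i, by rw [iot_inj Q hb, refl_root hord]⟩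

theorem root_euler (hord : OrdCompatible Q ord) {b : Q.V → ℤ} (hb : iot Q b ∈ qR Q) :
    euler Q b b = 1 := by
  obtain ⟨l, i, hb⟩ := hb
  rw [iot_inj Q hb, (qiso_word hord l).euler, euler_sim hord]

theorem root_lift {a : Q.V → ℚ} (ha : a ∈ qR Q) : ∃ b, iot Q b = a := by
  obtain ⟨l, i, hb⟩ := ha
  exact ⟨_, hb.symm⟩

theorem inW_root {w : (Q.V → ℤ) → (Q.V → ℤ)} (hw : InW Q w) {b : Q.V → ℤ}
    (hb : iot Q b ∈ qR Q) : iot Q (w b) ∈ qR Q := by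
  obtain ⟨l, rfl⟩ := hw
  obtain ⟨l', i, hb⟩ := hb
  refine ⟨l ++ l', i, ?_⟩
  rw [iot_inj Q hb, wordProd_append]; rfl

theorem inW_comp {w w' : (Q.V → ℤ) → (Q.V → ℤ)} (hw : InW Q w) (hw' : InW Q w') :
    InW Q (w ∘ w') := by
  obtain ⟨l, rfl⟩ := hw
  obtain ⟨l', rfl⟩ := hw'
  exact ⟨l ++ l', (wordProd_append Q l l').symm⟩

theorem inW_refl (t : (Q.V → ℤ) → (Q.V → ℤ)) (ht : IsRefl Q t) : InW Q t := by
  obtain ⟨l, i, rfl⟩ := ht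
  exact inW_comp ⟨l, rfl⟩ (inW_comp ⟨[i], rfl⟩ ⟨l.reverse, rfl⟩)

theorem qRoot (hord : OrdCompatible Q ord) : NcRoot (qE Q) (qR Q) := by
  constructor
  · intro a ha
    obtain ⟨b, rfl⟩ := root_lift ha
    rw [qE_iot, root_euler hord ha]; simp
  · intro a ha b hb
    obtain ⟨a, rfl⟩ := root_lift ha
    obtain ⟨b, rfl⟩ := root_lift hb
    rw [← iot_reflV]
    exact inW_root (inW_refl _ ((isRefl_iff hord _).2 ⟨b, hb, rfl⟩)) ha

end


section
variable {Q : FinQuiver} {ord : Fin (Fintype.card Q.V) ≃ Q.V}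

theorem q_nondeg (hft : FiniteType Q) {U : Submodule ℚ (Q.V → ℚ)} {y : Q.V → ℚ} (hy : y ∈ U)
    (h : ∀ z ∈ U, qE Q y z + qE Q z y = 0) : y = 0 := by
  have := h y hy
  exact qE_eq_zero Q hft y (by linarith)

theorem q_dual (hft : FiniteType Q) (v : Q.V) :
    ∃ d : Q.V → ℚ, ∀ x, qE Q d x + qE Q x d = x v := by
  let f : (Q.V → ℚ) →ₗ[ℚ] Module.Dual ℚ (Q.V → ℚ) := qE Q + (qE Q).flip
  have hinj : Function.Injective f := by
    rw [← LinearMap.ker_eq_bot, LinearMap.ker_eq_bot']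
    intro y hy
    refine q_nondeg hft (U := ⊤) trivial (fun z _ => ?_)
    exact LinearMap.congr_fun hy z
  have hsurj : Function.Surjective f :=
    (LinearMap.injective_iff_surjective_of_finrank_eq_finrank
      (by rw [Subspace.dual_finrank_eq])).1 hinj
  obtain ⟨d, hd⟩ := hsurj (LinearMap.proj v)
  exact ⟨d, fun x => LinearMap.congr_fun hd x⟩

theorem q_bound (hft : FiniteType Q) (v : Q.V) :
    ∃ N : ℤ, ∀ x : Q.V → ℤ, euler Q x x = 1 → -N ≤ x v ∧ x v ≤ N := by
  obtain ⟨d, hd⟩ := q_dual hft v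
  obtain ⟨N, hN⟩ := exists_int_gt (4 * qE Q d d)
  refine ⟨N, fun x hx => ?_⟩
  have hx1 : qE Q (iot Q x) (iot Q x) = 1 := by rw [qE_iot, hx]; simp
  have hB := hd (iot Q x)
  rw [iot_apply] at hB
  have hsq : ((x v : ℤ) : ℚ) ^ 2 ≤ 4 * qE Q d d := by
    by_cases hd0 : d = 0
    · rw [hd0] at hB ⊢
      simp only [map_zero, LinearMap.zero_apply, add_zero] at hB ⊢
      rw [← hB]; simp
    · have hA := qE_pos Q hft d hd0
      have hz : 0 ≤ qE Q ((2 * qE Q d d) • iot Q x - ((x v : ℤ) : ℚ) • d)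
          ((2 * qE Q d d) • iot Q x - ((x v : ℤ) : ℚ) • d) := by
        by_cases h0 : (2 * qE Q d d) • iot Q x - ((x v : ℤ) : ℚ) • d = 0
        · rw [h0]; simp
        · exact (qE_pos Q hft _ h0).le
      simp only [map_sub, map_smul, LinearMap.sub_apply, LinearMap.smul_apply, smul_eq_mul,
        hx1] at hz
      have e1 : qE Q (iot Q x) d = (x v : ℚ) - qE Q d (iot Q x) := by linarith
      rw [e1] at hz
      have hz' : 0 ≤ qE Q d d * (4 * qE Q d d - (x v : ℚ) ^ 2) := by linarith
      have := nonneg_of_mul_nonneg_right hz' hA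
      linarith
  have h2 : (x v) ^ 2 < N := by
    have : ((x v : ℤ) : ℚ) ^ 2 < N := lt_of_le_of_lt hsq hN
    exact_mod_cast this
  constructor <;> nlinarith [sq_nonneg (x v - 1), sq_nonneg (x v + 1)]

theorem qR_finite (hft : FiniteType Q) (hord : OrdCompatible Q ord) : (qR Q).Finite := by
  classical
  choose N hN using fun v => q_bound hft v
  have h1 : (Set.Icc (fun v => -N v) N).Finite := Set.finite_Icc _ _
  refine (h1.image (iot Q)).subset ?_
  intro a ha
  obtain ⟨b, rfl⟩ := root_lift ha
  have hb := root_euler hord ha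
  exact ⟨b, ⟨fun v => (hN v b hb).1, fun v => (hN v b hb).2⟩, rfl⟩

theorem euler_int_pos (hft : FiniteType Q) (x : Q.V → ℤ) (hx : x ≠ 0) : 1 ≤ euler Q x x := by
  have h : iot Q x ≠ 0 := fun h => hx (iot_inj Q (by rw [h, map_zero]))
  have := qE_pos Q hft _ h
  rw [qE_iot] at this
  have h2 : 0 < euler Q x x := by exact_mod_cast this
  omega

theorem euler_disj (p n : Q.V → ℤ) (hp : ∀ v, 0 ≤ p v) (hn : ∀ v, 0 ≤ n v)
    (h : ∀ v, p v * n v = 0) : euler Q p n ≤ 0 := by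
  rw [euler, Finset.sum_eq_zero (fun v _ => h v), zero_sub, neg_nonpos]
  exact Finset.sum_nonneg (fun a _ => mul_nonneg (hp _) (hn _))

theorem root_sign (hft : FiniteType Q) (x : Q.V → ℤ) (hx : euler Q x x = 1) :
    (∀ v, 0 ≤ x v) ∨ (∀ v, x v ≤ 0) := by
  by_contra hcon
  push Not at hcon
  obtain ⟨⟨v, hv⟩, ⟨u, hu⟩⟩ := hcon
  let p : Q.V → ℤ := fun v => max (x v) 0
  let n : Q.V → ℤ := fun v => max (-x v) 0
  have hpn : x = p - n := by
    funext v
    simp only [p, n, Pi.sub_apply]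
    omega
  have hp : p ≠ 0 := fun h => by
    have := congrFun h u
    simp only [p, Pi.zero_apply] at this
    omega
  have hn : n ≠ 0 := fun h => by
    have := congrFun h v
    simp only [n, Pi.zero_apply] at this
    omega
  have hz : ∀ v, p v * n v = 0 := by
    intro v
    simp only [p, n]
    rcases le_total (x v) 0 with h | h
    · rw [max_eq_right h, zero_mul]
    · rw [max_eq_right (a := -x v) (by omega), mul_zero]
  have h1 := euler_int_pos hft p hp
  have h2 := euler_int_pos hft n hn
  have h3 := euler_disj (Q := Q) p n (fun v => le_max_right _ _) (fun v => le_max_right _ _) hz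
  have h4 := euler_disj (Q := Q) n p (fun v => le_max_right _ _) (fun v => le_max_right _ _)
    (fun v => by rw [mul_comm]; exact hz v)
  have h5 : (1 : ℚ) = euler Q p p - euler Q p n - euler Q n p + euler Q n n := by
    have : qE Q (iot Q x) (iot Q x) = 1 := by rw [qE_iot, hx]; simp
    rw [← this, hpn, map_sub]
    simp only [map_sub, LinearMap.sub_apply, qE_iot]
    ring
  have h6 : 1 = euler Q p p - euler Q p n - euler Q n p + euler Q n n := by exact_mod_cast h5
  omega

theorem q_expand (x : Q.V → ℚ) : x = ∑ v, x v • iot Q (simRoot Q v) := by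
  classical
  funext u
  simp [Finset.sum_apply, iot_apply, simRoot]

/-- the initial list of simple roots -/
def qD (Q : FinQuiver) (ord : Fin (Fintype.card Q.V) ≃ Q.V) : List (Q.V → ℚ) :=
  (List.ofFn (fun i => iot Q (simRoot Q (ord i)))).reverse

theorem mem_qD (v : Q.V) : iot Q (simRoot Q v) ∈ qD Q ord := by
  rw [qD, List.mem_reverse, List.mem_ofFn]
  exact ⟨ord.symm v, by simp⟩

theorem qD_span : Submodule.span ℚ {a | a ∈ qD Q ord} = ⊤ := by
  rw [eq_top_iff]
  intro x _
  rw [q_expand x]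
  exact Submodule.sum_mem _ (fun v _ => Submodule.smul_mem _ _
    (Submodule.subset_span (mem_qD v)))

theorem qD_st (hft : FiniteType Q) (hord : OrdCompatible Q ord) :
    NcSt (qE Q) (qR Q) (qD Q ord) := by
  refine ⟨?_, ?_, ?_⟩
  · intro a ha
    rw [qD, List.mem_reverse, List.mem_ofFn] at ha
    obtain ⟨i, rfl⟩ := ha
    exact ⟨[], ord i, rfl⟩
  · rw [qD, List.pairwise_reverse, List.pairwise_ofFn]
    intro i j hij
    have hne : ord j ≠ ord i := fun h => hij.ne' (ord.injective h)
    constructor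
    · rw [qE_iot, euler_sim_zero _ _ hne]
      · simp
      · refine ⟨fun a => ?_⟩
        have := hord _ _ a
        simp only [Equiv.symm_apply_apply] at this
        exact lt_asymm hij this
    · rw [qE_iot]
      exact_mod_cast euler_sim_ne _ _ hne.symm
  · have key : ∀ x : Q.V → ℤ, (∀ v, 0 ≤ x v) → iot Q x ∈ ncCone {b | b ∈ qD Q ord} := by
      intro x hx
      rw [q_expand (iot Q x)]
      exact sum_mem (fun v _ => ncCone_smul_mem (s := {b | b ∈ qD Q ord}) (mem_qD v)
        (by rw [iot_apply]; exact_mod_cast hx v))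
    intro a ha
    obtain ⟨b, rfl⟩ := root_lift ha
    rcases root_sign hft b (root_euler hord ha) with h | h
    · exact Or.inl (key b h)
    · right
      rw [← map_neg]
      exact key (-b) (fun v => by simpa using h v)

theorem q_init (hft : FiniteType Q) (hord : OrdCompatible Q ord) :
    ∃ L : List (Q.V → ℚ), NcDir (qE Q) (qR Q) L ∧ NcG (qE Q) L ⊤ :=
  nc_init (qRoot hord) (qR_finite hft hord) (qD_st hft hord) qD_span

end


/-- `w` is the Coxeter-like element of the subspace `U` -/
structure DD (Q : FinQuiver) (U : Submodule ℚ (Q.V → ℚ)) (w : (Q.V → ℤ) → (Q.V → ℤ)) :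
    Prop where
  mem : ∀ x, iot Q (w x) - iot Q x ∈ U
  eq : ∀ x, ∀ y ∈ U, qE Q y (iot Q (w x) - iot Q x) =
    -(qE Q y (iot Q x) + qE Q (iot Q x) y)

/-- product of the reflections in a list of vectors -/
def rprod (Q : FinQuiver) (bs : List (Q.V → ℤ)) : (Q.V → ℤ) → (Q.V → ℤ) :=
  (bs.map (reflV Q)).foldr (· ∘ ·) id

section
variable {Q : FinQuiver} {ord : Fin (Fintype.card Q.V) ≃ Q.V}

theorem rprod_cons (b : Q.V → ℤ) (bs : List (Q.V → ℤ)) :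
    rprod Q (b :: bs) = reflV Q b ∘ rprod Q bs := rfl

theorem DD.unique (hft : FiniteType Q) {U : Submodule ℚ (Q.V → ℚ)}
    {w w' : (Q.V → ℤ) → (Q.V → ℤ)} (h : DD Q U w) (h' : DD Q U w') : w = w' := by
  funext x
  apply iot_inj Q
  have h1 : iot Q (w x) - iot Q (w' x) ∈ U := by
    have := U.sub_mem (h.mem x) (h'.mem x)
    rwa [sub_sub_sub_cancel_right] at this
  have h2 := h.eq x _ h1
  have h3 := h'.eq x _ h1
  rw [← sub_eq_zero]
  apply qE_eq_zero Q hft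
  rw [← h3] at h2
  rw [map_sub (qE Q (iot Q (w x) - iot Q (w' x))),
    map_sub (qE Q (iot Q (w x) - iot Q (w' x)))] at h2
  rw [map_sub (qE Q (iot Q (w x) - iot Q (w' x)))]
  linarith

theorem DD.bot : DD Q ⊥ id := by
  constructor
  · intro x; simp
  · intro x y hy
    rw [Submodule.mem_bot] at hy
    simp [hy]

theorem DD.comp {U1 U2 : Submodule ℚ (Q.V → ℚ)} {w1 w2 : (Q.V → ℤ) → (Q.V → ℤ)}
    (h1 : DD Q U1 w1) (h2 : DD Q U2 w2) (h : ∀ a ∈ U1, ∀ b ∈ U2, qE Q b a = 0) :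
    DD Q (U1 ⊔ U2) (w1 ∘ w2) := by
  have e : ∀ x, iot Q ((w1 ∘ w2) x) - iot Q x =
      (iot Q (w1 (w2 x)) - iot Q (w2 x)) + (iot Q (w2 x) - iot Q x) := by
    intro x; simp
  constructor
  · intro x
    rw [e]
    exact Submodule.add_mem_sup (h1.mem _) (h2.mem _)
  · intro x y hy
    obtain ⟨a, ha, b, hb, rfl⟩ := Submodule.mem_sup.1 hy
    rw [e]
    have k1 := h1.eq (w2 x) a ha
    have k2 := h2.eq x b hb
    have k3 := h _ (h1.mem (w2 x)) b hb
    have k4 := h a ha _ (h2.mem x)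
    simp only [map_add, map_sub, LinearMap.add_apply, LinearMap.sub_apply] at *
    linarith

theorem DD.refl {b : Q.V → ℤ} (hb : euler Q b b = 1) :
    DD Q (Submodule.span ℚ {iot Q b}) (reflV Q b) := by
  have hb' : qE Q (iot Q b) (iot Q b) = 1 := by rw [qE_iot, hb]; simp
  have e : ∀ x, iot Q (reflV Q b x) - iot Q x =
      (-(qE Q (iot Q b) (iot Q x) + qE Q (iot Q x) (iot Q b))) • iot Q b := by
    intro x; rw [iot_reflV, ncS_apply]; module
  constructor
  · intro x
    rw [e]
    exact Submodule.smul_mem _ _ (Submodule.mem_span_singleton_self _)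
  · intro x y hy
    obtain ⟨c, rfl⟩ := Submodule.mem_span_singleton.1 hy
    rw [e]
    simp only [map_smul, LinearMap.smul_apply, smul_eq_mul, hb']
    ring

theorem DD.list (bs : List (Q.V → ℤ)) (h1 : ∀ b ∈ bs, euler Q b b = 1)
    (h2 : bs.Pairwise (fun a b => euler Q b a = 0)) :
    DD Q (Submodule.span ℚ {a | a ∈ bs.map (iot Q)}) (rprod Q bs) := by
  induction bs with
  | nil =>
    have : {a | a ∈ List.map (iot Q) []} = (∅ : Set (Q.V → ℚ)) := by ext; simp
    rw [this, Submodule.span_empty]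
    exact DD.bot
  | cons b bs ih =>
    have hp := List.pairwise_cons.1 h2
    have : {a | a ∈ List.map (iot Q) (b :: bs)} = {iot Q b} ∪ {a | a ∈ bs.map (iot Q)} := by
      ext; simp
    rw [this, Submodule.span_union, rprod_cons]
    refine DD.comp (DD.refl (h1 b List.mem_cons_self))
      (ih (fun a ha => h1 a (List.mem_cons_of_mem _ ha)) hp.2) ?_
    intro a ha c hc
    obtain ⟨r, rfl⟩ := Submodule.mem_span_singleton.1 ha
    have : Submodule.span ℚ {a | a ∈ bs.map (iot Q)} ≤
        LinearMap.ker ((qE Q).flip (iot Q b)) := by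
      rw [Submodule.span_le]
      intro d hd
      obtain ⟨d', hd', rfl⟩ := List.mem_map.1 hd
      simp only [SetLike.mem_coe, LinearMap.mem_ker, LinearMap.flip_apply]
      rw [qE_iot, hp.1 d' hd']; simp
    have h3 := this hc
    simp only [LinearMap.mem_ker, LinearMap.flip_apply] at h3
    rw [map_smul, h3, smul_zero]

theorem coxeter_eq : coxeter Q ord = rprod Q (List.ofFn (fun i => simRoot Q (ord i))) := by
  rw [coxeter, comps, rprod, List.map_ofFn]; rfl

theorem DD.cox (hord : OrdCompatible Q ord) : DD Q ⊤ (coxeter Q ord) := by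
  have h := DD.list (Q := Q) (List.ofFn (fun i => simRoot Q (ord i))) (by
    intro b hb
    rw [List.mem_ofFn] at hb
    obtain ⟨i, rfl⟩ := hb
    exact euler_sim hord _) (by
    rw [List.pairwise_ofFn]
    intro i j hij
    refine euler_sim_zero _ _ (fun h => hij.ne' (ord.injective h)) ⟨fun a => ?_⟩
    have := hord _ _ a
    simp only [Equiv.symm_apply_apply] at this
    exact lt_asymm hij this)
  rw [coxeter_eq]
  convert h
  rw [← qD_span (ord := ord)]
  congr 1
  ext a
  rw [qD]
  simp [List.map_ofFn, List.mem_ofFn]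

theorem DD.removal {U : Submodule ℚ (Q.V → ℚ)} {v : (Q.V → ℤ) → (Q.V → ℤ)}
    (h : DD Q U v) {b : Q.V → ℤ} (hb : euler Q b b = 1) (hbU : iot Q b ∈ U) :
    DD Q (U ⊓ LinearMap.ker (qE Q (iot Q b))) (v ∘ reflV Q b) := by
  have hb' : qE Q (iot Q b) (iot Q b) = 1 := by rw [qE_iot, hb]; simp
  have e : ∀ x, iot Q ((v ∘ reflV Q b) x) - iot Q x =
      (iot Q (v (reflV Q b x)) - iot Q (reflV Q b x)) +
      (-(qE Q (iot Q b) (iot Q x) + qE Q (iot Q x) (iot Q b))) • iot Q b := by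
    intro x
    have : iot Q x = iot Q (reflV Q b x) +
      ((qE Q (iot Q b) (iot Q x) + qE Q (iot Q x) (iot Q b))) • iot Q b := by
      rw [iot_reflV, ncS_apply]; module
    rw [Function.comp_apply]
    nth_rw 1 [this]
    module
  constructor
  · intro x
    rw [e]
    refine ⟨U.add_mem (h.mem _) (U.smul_mem _ hbU), ?_⟩
    have h1 := h.eq (reflV Q b x) _ hbU
    rw [SetLike.mem_coe, LinearMap.mem_ker, map_add, h1, iot_reflV, ncS_apply]
    simp only [map_sub, map_smul, LinearMap.sub_apply, LinearMap.smul_apply, smul_eq_mul, hb']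
    ring
  · intro x y hy
    have h1 := h.eq (reflV Q b x) y hy.1
    have h2 : qE Q (iot Q b) y = 0 := hy.2
    rw [e, map_add, h1, iot_reflV, ncS_apply]
    simp only [map_sub, map_smul, LinearMap.sub_apply, LinearMap.smul_apply, smul_eq_mul, h2]
    ring

theorem finrank_perp {U : Submodule ℚ (Q.V → ℚ)} {b : Q.V → ℚ} (hb : qE Q b b = 1)
    (hbU : b ∈ U) :
    Module.finrank ℚ (U ⊓ LinearMap.ker (qE Q b) : Submodule ℚ (Q.V → ℚ)) + 1 =
      Module.finrank ℚ U := by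
  have hb0 : b ≠ 0 := by rintro rfl; simp at hb
  have h := Submodule.finrank_sup_add_finrank_inf_eq (U ⊓ LinearMap.ker (qE Q b))
    (Submodule.span ℚ {b})
  have h1 : (U ⊓ LinearMap.ker (qE Q b)) ⊔ Submodule.span ℚ {b} = U := by
    apply le_antisymm
    · refine sup_le inf_le_left ?_
      rw [Submodule.span_singleton_le_iff_mem]; exact hbU
    · intro x hx
      rw [Submodule.mem_sup]
      refine ⟨x - qE Q b x • b, ⟨U.sub_mem hx (U.smul_mem _ hbU), ?_⟩, qE Q b x • b,
        Submodule.smul_mem _ _ (Submodule.mem_span_singleton_self _), by simp⟩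
      simp [hb]
  have h2 : (U ⊓ LinearMap.ker (qE Q b)) ⊓ Submodule.span ℚ {b} = ⊥ := by
    rw [eq_bot_iff]
    rintro x ⟨⟨_, hx⟩, hx2⟩
    obtain ⟨c, rfl⟩ := Submodule.mem_span_singleton.1 hx2
    simp [hb] at hx
    simp [hx]
  rw [h1, h2, finrank_bot, finrank_span_singleton hb0] at h
  omega

theorem rprod_append (bs cs : List (Q.V → ℤ)) :
    rprod Q (bs ++ cs) = rprod Q bs ∘ rprod Q cs := by
  induction bs with
  | nil => rfl
  | cons b bs ih => rw [List.cons_append, rprod_cons, ih, rprod_cons]; rfl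

theorem rprod_single (b : Q.V → ℤ) : rprod Q [b] = reflV Q b := rfl

theorem rprod_sub (bs : List (Q.V → ℤ)) (x : Q.V → ℤ) :
    iot Q (rprod Q bs x) - iot Q x ∈ Submodule.span ℚ {a | a ∈ bs.map (iot Q)} := by
  induction bs with
  | nil => simp [rprod]
  | cons b bs ih =>
    rw [rprod_cons, Function.comp_apply, iot_reflV, ncS_apply, sub_right_comm]
    refine Submodule.sub_mem _ (Submodule.span_mono ?_ ih)
      (Submodule.smul_mem _ _ (Submodule.subset_span ?_))
    · intro a ha
      simp only [Set.mem_ofPred_eq, List.map_cons, List.mem_cons] at *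
      exact Or.inr ha
    · simp

theorem DD.le (hft : FiniteType Q) {U G : Submodule ℚ (Q.V → ℚ)}
    {v : (Q.V → ℤ) → (Q.V → ℤ)} (h : DD Q U v) (hG : ∀ x, iot Q (v x) - iot Q x ∈ G) :
    U ≤ G := by
  by_contra hle
  have hlt : U ⊓ G < U := lt_of_le_of_ne inf_le_left (fun h => hle (inf_eq_left.1 h))
  have hfr := Submodule.finrank_lt_finrank_of_lt hlt
  let f : U →ₗ[ℚ] Module.Dual ℚ (U ⊓ G : Submodule ℚ (Q.V → ℚ)) :=
    ((Submodule.subtype (U ⊓ G)).dualMap).comp ((qE Q).comp U.subtype)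
  have hker : LinearMap.ker f ≠ ⊥ :=
    LinearMap.ker_ne_bot_of_finrank_lt (by rw [Subspace.dual_finrank_eq]; exact hfr)
  obtain ⟨y, hy, hy0⟩ := Submodule.exists_mem_ne_zero_of_ne_bot hker
  apply hy0
  have hy1 : ∀ x : Q.V → ℤ, qE Q y (iot Q x) + qE Q (iot Q x) y = 0 := by
    intro x
    have h1 := h.eq x y y.2
    have h2 : f y ⟨iot Q (v x) - iot Q x, ⟨h.mem x, hG x⟩⟩ = 0 := by
      rw [LinearMap.mem_ker.1 hy]; rfl
    have h3 : f y ⟨iot Q (v x) - iot Q x, ⟨h.mem x, hG x⟩⟩ =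
      qE Q y (iot Q (v x) - iot Q x) := rfl
    linarith
  have : (y : Q.V → ℚ) = 0 := by
    refine q_nondeg hft (U := ⊤) trivial (fun z _ => ?_)
    rw [q_expand z]
    simp only [map_sum, map_smul, LinearMap.sum_apply, LinearMap.smul_apply, smul_eq_mul]
    rw [← Finset.sum_add_distrib]
    apply Finset.sum_eq_zero
    intro u _
    rw [← mul_add, hy1, mul_zero]
  exact Subtype.ext this

theorem ellT_set (hord : OrdCompatible Q ord) (w : (Q.V → ℤ) → (Q.V → ℤ)) (m : ℕ) :
    (∃ f : Fin m → ((Q.V → ℤ) → (Q.V → ℤ)), (∀ i, IsRefl Q (f i)) ∧ w = comps Q f) ↔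
    ∃ bs : List (Q.V → ℤ), bs.length = m ∧ (∀ b ∈ bs, iot Q b ∈ qR Q) ∧ w = rprod Q bs := by
  constructor
  · rintro ⟨f, hf, rfl⟩
    choose b hb hb2 using fun i => (isRefl_iff hord _).1 (hf i)
    refine ⟨List.ofFn b, by simp, ?_, ?_⟩
    · intro c hc
      rw [List.mem_ofFn] at hc
      obtain ⟨i, rfl⟩ := hc
      exact hb i
    · rw [comps, rprod, List.map_ofFn]
      congr 2
      funext i
      exact hb2 i
  · rintro ⟨bs, rfl, hbs, rfl⟩
    refine ⟨fun i => reflV Q (bs.get i), fun i => (isRefl_iff hord _).2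
      ⟨_, hbs _ (List.get_mem _ _), rfl⟩, ?_⟩
    rw [comps, rprod]
    congr 1
    have := List.map_ofFn (f := bs.get) (g := reflV Q)
    rw [List.ofFn_get] at this
    exact this

theorem ellT_le (hord : OrdCompatible Q ord) (bs : List (Q.V → ℤ))
    (h : ∀ b ∈ bs, iot Q b ∈ qR Q) : ellT Q (rprod Q bs) ≤ bs.length :=
  Nat.sInf_le ((ellT_set hord _ _).2 ⟨bs, rfl, h, rfl⟩)

theorem ellT_att (hord : OrdCompatible Q ord) (bs : List (Q.V → ℤ))
    (h : ∀ b ∈ bs, iot Q b ∈ qR Q) : ∃ cs : List (Q.V → ℤ),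
      cs.length = ellT Q (rprod Q bs) ∧ (∀ b ∈ cs, iot Q b ∈ qR Q) ∧
      rprod Q bs = rprod Q cs :=
  (ellT_set hord _ _).1 (Nat.sInf_mem
    (s := { m | ∃ f : Fin m → ((Q.V → ℤ) → (Q.V → ℤ)), (∀ i, IsRefl Q (f i)) ∧
      rprod Q bs = comps Q f }) ⟨_, (ellT_set hord _ _).2 ⟨bs, rfl, h, rfl⟩⟩)

theorem finrank_list (l : List (Q.V → ℚ)) :
    Module.finrank ℚ (Submodule.span ℚ {a | a ∈ l}) ≤ l.length := by
  classical
  have : {a | a ∈ l} = (l.toFinset : Set (Q.V → ℚ)) := by ext; simp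
  rw [this]
  exact (finrank_span_finset_le_card _).trans (List.toFinset_card_le l)

theorem DD.finrank_le (hft : FiniteType Q) {U : Submodule ℚ (Q.V → ℚ)}
    (bs : List (Q.V → ℤ)) (h : DD Q U (rprod Q bs)) : Module.finrank ℚ U ≤ bs.length := by
  have h1 := h.le hft (rprod_sub bs)
  have h2 := Submodule.finrank_mono h1
  have h3 := finrank_list (Q := Q) (bs.map (iot Q))
  rw [List.length_map] at h3
  omega

variable {L : List (Q.V → ℚ)}

theorem ncg_perp (hord : OrdCompatible Q ord) (hL : NcDir (qE Q) (qR Q) L)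
    {U : Submodule ℚ (Q.V → ℚ)} (hG : NcG (qE Q) L U) {b : Q.V → ℚ} (hb : b ∈ qR Q)
    (hbU : b ∈ U) : NcG (qE Q) L (U ⊓ LinearMap.ker (qE Q b)) := by
  rcases hL.all b hb with h | h
  · exact hG.perp (qRoot hord) hL h hbU
  · have := hG.perp (qRoot hord) hL h (U.neg_mem hbU)
    have e : LinearMap.ker (qE Q (-b)) = LinearMap.ker (qE Q b) := by
      ext x; simp
    rwa [e] at this

theorem ell_exists (hft : FiniteType Q) (hord : OrdCompatible Q ord)
    (hL : NcDir (qE Q) (qR Q) L) (n : ℕ) :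
    ∀ (U : Submodule ℚ (Q.V → ℚ)) (w : (Q.V → ℤ) → (Q.V → ℤ)), Module.finrank ℚ U = n →
    NcG (qE Q) L U → DD Q U w →
    ∃ bs : List (Q.V → ℤ), bs.length = n ∧ (∀ b ∈ bs, iot Q b ∈ qR Q) ∧ w = rprod Q bs := by
  induction n with
  | zero =>
    intro U w hU _ hw
    rw [Submodule.finrank_eq_zero] at hU
    subst hU
    exact ⟨[], rfl, by simp, hw.unique hft DD.bot⟩
  | succ n ih =>
    intro U w hU hG hw
    obtain ⟨b, hbL, hbU⟩ : ∃ b ∈ L, b ∈ U := by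
      obtain ⟨D, hD⟩ := hG
      have hne : D.Nonempty := by
        by_contra hne
        rw [Set.not_nonempty_iff_eq_empty] at hne
        have := hD.span
        rw [hne, Submodule.span_empty] at this
        rw [← this, finrank_bot] at hU
        omega
      obtain ⟨b, hb⟩ := hne
      exact ⟨b, hD.sub b hb, hD.span ▸ Submodule.subset_span hb⟩
    have hbR := hL.sub b hbL
    obtain ⟨b, rfl⟩ := root_lift hbR
    have hb1 := root_euler hord hbR
    have hfr := finrank_perp ((qRoot hord).one _ hbR) hbU
    obtain ⟨bs, h1, h2, h3⟩ := ih _ _ (by omega) (ncg_perp hord hL hG hbR hbU)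
      (hw.removal hb1 hbU)
    refine ⟨bs ++ [b], by simp [h1], ?_, ?_⟩
    · intro c hc
      rcases List.mem_append.1 hc with hc | hc
      · exact h2 c hc
      · rw [List.mem_singleton.1 hc]; exact hbR
    · rw [rprod_append, ← h3, rprod_single]
      funext x
      simp [reflV_reflV hb1]

theorem ell_eq (hft : FiniteType Q) (hord : OrdCompatible Q ord)
    (hL : NcDir (qE Q) (qR Q) L) {U : Submodule ℚ (Q.V → ℚ)} {w : (Q.V → ℤ) → (Q.V → ℤ)}
    (hG : NcG (qE Q) L U) (hw : DD Q U w) : ellT Q w = Module.finrank ℚ U := by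
  obtain ⟨bs, h1, h2, rfl⟩ := ell_exists hft hord hL _ U w rfl hG hw
  apply le_antisymm
  · rw [← h1]; exact ellT_le hord bs h2
  · obtain ⟨cs, h3, h4, h5⟩ := ellT_att hord bs h2
    rw [← h3]
    rw [h5] at hw
    exact hw.finrank_le hft

theorem inW_rprod (hord : OrdCompatible Q ord) (bs : List (Q.V → ℤ))
    (h : ∀ b ∈ bs, iot Q b ∈ qR Q) : InW Q (rprod Q bs) := by
  induction bs with
  | nil => exact ⟨[], rfl⟩
  | cons b bs ih =>
    rw [rprod_cons]
    exact inW_comp (inW_refl _ ((isRefl_iff hord _).2 ⟨b, h b List.mem_cons_self, rfl⟩))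
      (ih (fun c hc => h c (List.mem_cons_of_mem _ hc)))

theorem ell_inW (hft : FiniteType Q) (hord : OrdCompatible Q ord)
    (hL : NcDir (qE Q) (qR Q) L) {U : Submodule ℚ (Q.V → ℚ)} {w : (Q.V → ℤ) → (Q.V → ℤ)}
    (hG : NcG (qE Q) L U) (hw : DD Q U w) : InW Q w := by
  obtain ⟨bs, h1, h2, rfl⟩ := ell_exists hft hord hL _ U w rfl hG hw
  exact inW_rprod hord bs h2

theorem dd_step (hft : FiniteType Q) (hord : OrdCompatible Q ord)
    (hL : NcDir (qE Q) (qR Q) L) {U : Submodule ℚ (Q.V → ℚ)} {u v : (Q.V → ℤ) → (Q.V → ℤ)}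
    (hG : NcG (qE Q) L U) (hv : DD Q U v)
    (h : ∃ t, IsRefl Q t ∧ v = u ∘ t ∧ ellT Q v = ellT Q u + 1) :
    ∃ U' ≤ U, NcG (qE Q) L U' ∧ DD Q U' u := by
  obtain ⟨t, ht, hvu, hl⟩ := h
  obtain ⟨b, hbR, rfl⟩ := (isRefl_iff hord _).1 ht
  have hb1 := root_euler hord hbR
  have huv : u = v ∘ reflV Q b := by
    rw [hvu]; funext x; simp [reflV_reflV hb1]
  have hfr := ell_eq hft hord hL hG hv
  obtain ⟨bs, h1, h2, h3⟩ := ell_exists hft hord hL _ U v rfl hG hv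
  obtain ⟨cs, h4, h5, h6⟩ := ellT_att hord (bs ++ [b]) (by
    intro c hc
    rcases List.mem_append.1 hc with hc | hc
    · exact h2 c hc
    · rw [List.mem_singleton.1 hc]; exact hbR)
  have hu : u = rprod Q (bs ++ [b]) := by rw [huv, h3, rprod_append, rprod_single]
  rw [← hu] at h4 h6
  have hv2 : v = rprod Q (cs ++ [b]) := by rw [hvu, h6, rprod_append, rprod_single]
  have hle : U ≤ Submodule.span ℚ {a | a ∈ (cs ++ [b]).map (iot Q)} :=
    hv.le hft (fun x => by rw [hv2]; exact rprod_sub _ x)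
  have heq := Submodule.eq_of_le_of_finrank_le hle (by
    refine (finrank_list _).trans ?_
    simp only [List.length_map, List.length_append, List.length_singleton]
    omega)
  have hbU : iot Q b ∈ U := by
    rw [heq]
    exact Submodule.subset_span (by simp)
  exact ⟨_, inf_le_left, ncg_perp hord hL hG hbR hbU, huv ▸ hv.removal hb1 hbU⟩

theorem dd_desc (hft : FiniteType Q) (hord : OrdCompatible Q ord)
    (hL : NcDir (qE Q) (qR Q) L) {U : Submodule ℚ (Q.V → ℚ)} {z x : (Q.V → ℤ) → (Q.V → ℤ)}
    (hG : NcG (qE Q) L U) (hx : DD Q U x) (h : absLe Q z x) :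
    ∃ U' ≤ U, NcG (qE Q) L U' ∧ DD Q U' z := by
  induction h using Relation.ReflTransGen.head_induction_on with
  | refl => exact ⟨U, le_rfl, hG, hx⟩
  | head h1 _ ih =>
    obtain ⟨U1, hU1, hG1, hD1⟩ := ih
    obtain ⟨U2, hU2, hG2, hD2⟩ := dd_step hft hord hL hG1 hD1 h1
    exact ⟨U2, hU2.trans hU1, hG2, hD2⟩

theorem dd_chain (hft : FiniteType Q) (hord : OrdCompatible Q ord)
    (hL : NcDir (qE Q) (qR Q) L) (S : List (Q.V → ℚ)) (hS : ∀ a ∈ S, a ∈ L)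
    (hpw : S.Pairwise (fun a b => qE Q b a = 0)) (n : ℕ) :
    ∀ (U : Submodule ℚ (Q.V → ℚ)) (x : (Q.V → ℤ) → (Q.V → ℤ)), Module.finrank ℚ U = n →
    NcG (qE Q) L U → DD Q U x → Submodule.span ℚ {a | a ∈ S} ≤ U →
    NcG (qE Q) L (Submodule.span ℚ {a | a ∈ S}) ∧
      ∃ m, DD Q (Submodule.span ℚ {a | a ∈ S}) m ∧ absLe Q m x := by
  induction n with
  | zero =>
    intro U x hU hG hx hle
    rw [Submodule.finrank_eq_zero] at hU
    subst hU
    rw [le_bot_iff.1 hle]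
    exact ⟨hG, x, hx, Relation.ReflTransGen.refl⟩
  | succ n ih =>
    intro U x hU hG hx hle
    by_cases hle2 : U ≤ Submodule.span ℚ {a | a ∈ S}
    · rw [le_antisymm hle hle2]
      exact ⟨hG, x, hx, Relation.ReflTransGen.refl⟩
    · have hSU : ∀ a ∈ S, a ∈ U := fun a ha => hle (Submodule.subset_span ha)
      obtain ⟨d, hdL, hdU, hd⟩ := nc_rightPerp (qRoot hord) hL S.reverse U hG
        (fun a ha => ⟨hS a (List.mem_reverse.1 ha), hSU a (List.mem_reverse.1 ha)⟩)
        (by rw [List.pairwise_reverse]; exact hpw)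
        (by simpa using hle2)
      have hdR := hL.sub d hdL
      obtain ⟨d, rfl⟩ := root_lift hdR
      obtain ⟨l, hl⟩ := ell_inW hft hord hL hG hx
      obtain ⟨b, hb⟩ : ∃ b, b = wordProd Q l.reverse d := ⟨_, rfl⟩
      have hxb : x b = d := by rw [hl, hb]; exact word_rev' hord l d
      have hbR : iot Q b ∈ qR Q := hb ▸ inW_root ⟨_, rfl⟩ hdR
      have hb1 := root_euler hord hbR
      have hbU : iot Q b ∈ U := by
        have h1 := hx.mem b
        rw [hxb] at h1
        have := U.sub_mem hdU h1
        rwa [sub_sub_cancel] at this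
      have hEb : ∀ a ∈ S, qE Q (iot Q b) a = 0 := by
        intro a ha
        have h1 := hx.eq b a (hSU a ha)
        rw [hxb, map_sub, hd a (List.mem_reverse.2 ha)] at h1
        linarith
      have hG1 := ncg_perp hord hL hG hbR hbU
      have hD1 := hx.removal hb1 hbU
      have hfr := finrank_perp ((qRoot hord).one _ hbR) hbU
      have hle1 : Submodule.span ℚ {a | a ∈ S} ≤ U ⊓ LinearMap.ker (qE Q (iot Q b)) := by
        rw [Submodule.span_le]
        intro a ha
        exact ⟨hSU a ha, hEb a ha⟩
      obtain ⟨h1, m, hm, hmx⟩ := ih _ _ (by omega) hG1 hD1 hle1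
      refine ⟨h1, m, hm, hmx.tail ⟨reflV Q b, (isRefl_iff hord _).2 ⟨b, hbR, rfl⟩, ?_, ?_⟩⟩
      · funext y; simp [reflV_reflV hb1]
      · rw [ell_eq hft hord hL hG hx, ell_eq hft hord hL hG1 hD1, hfr]

theorem q_meet (hft : FiniteType Q) (hord : OrdCompatible Q ord)
    (hL : NcDir (qE Q) (qR Q) L) {U1 U2 : Submodule ℚ (Q.V → ℚ)}
    {x y : (Q.V → ℤ) → (Q.V → ℤ)} (hG1 : NcG (qE Q) L U1) (hx : DD Q U1 x)
    (hG2 : NcG (qE Q) L U2) (hy : DD Q U2 y) :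
    ∃ m U, U ≤ U1 ∧ U ≤ U2 ∧ NcG (qE Q) L U ∧ DD Q U m ∧ absLe Q m x ∧ absLe Q m y ∧
      ∀ U' z, NcG (qE Q) L U' → DD Q U' z → U' ≤ U1 → U' ≤ U2 → absLe Q z m := by
  obtain ⟨S, hS, hSU, hpw, hall⟩ := nc_meet (qRoot hord) hL hG1 hG2
  have le1 : Submodule.span ℚ {a | a ∈ S} ≤ U1 :=
    Submodule.span_le.2 (fun a ha => (hSU a ha).1)
  have le2 : Submodule.span ℚ {a | a ∈ S} ≤ U2 :=
    Submodule.span_le.2 (fun a ha => (hSU a ha).2)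
  obtain ⟨hG, m, hm, hmx⟩ := dd_chain hft hord hL S hS hpw _ U1 x rfl hG1 hx le1
  obtain ⟨_, m', hm', hmy⟩ := dd_chain hft hord hL S hS hpw _ U2 y rfl hG2 hy le2
  rw [hm'.unique hft hm] at hmy
  refine ⟨m, _, le1, le2, hG, hm, hmx, hmy, ?_⟩
  intro U' z hG' hz h1 h2
  obtain ⟨T, hT, hTU, hTpw, hTall⟩ := nc_meet (qRoot hord) hL hG' hG'
  have hUT : Submodule.span ℚ {a | a ∈ T} = U' := by
    apply le_antisymm
    · exact Submodule.span_le.2 (fun a ha => (hTU a ha).1)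
    · obtain ⟨D, hD⟩ := hG'
      nth_rw 1 [← hD.span]
      rw [Submodule.span_le]
      intro a ha
      have haU : a ∈ U' := hD.span ▸ Submodule.subset_span ha
      exact hTall a (hD.sub a ha) haU haU
  obtain ⟨_, z', hz', hzm⟩ := dd_chain hft hord hL T hT hTpw _ _ m rfl hG hm
    (Submodule.span_le.2 (fun a ha => hall a (hT a ha) (h1 (hTU a ha).1) (h2 (hTU a ha).1)))
  rw [hUT] at hz'
  rw [hz.unique hft hz']
  exact hzm

end


section Statement17

/-- If `Q` is an orientation of a Dynkin diagram then the poset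
`NC_Q = [e, cox(Q)]` of noncrossing partitions of the associated finite Coxeter group
(under absolute order) is a lattice: every pair of elements has a greatest lower bound
and a least upper bound in `NC_Q`. -/
theorem statement17 (Q : FinQuiver) (hft : FiniteType Q)
    (ord : Fin (Fintype.card Q.V) ≃ Q.V) (hord : OrdCompatible Q ord) :
    ∀ x ∈ NCSet Q ord, ∀ y ∈ NCSet Q ord,
      (∃ m ∈ NCSet Q ord, absLe Q m x ∧ absLe Q m y ∧
        ∀ z ∈ NCSet Q ord, absLe Q z x → absLe Q z y → absLe Q z m) ∧
      (∃ j ∈ NCSet Q ord, absLe Q x j ∧ absLe Q y j ∧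
        ∀ z ∈ NCSet Q ord, absLe Q x z → absLe Q y z → absLe Q j z) := by
  obtain ⟨L, hL, hT⟩ := q_init hft hord
  have hc := DD.cox hord
  have desc : ∀ {U : Submodule ℚ (Q.V → ℚ)} {U' : Submodule ℚ (Q.V → ℚ)}
      {z x : (Q.V → ℤ) → (Q.V → ℤ)}, NcG (qE Q) L U → DD Q U x → absLe Q z x → DD Q U' z →
      U' ≤ U := by
    intro U U' z x hG hx hz hD
    obtain ⟨U2, h1, _, h3⟩ := dd_desc hft hord hL hG hx hz
    exact (hD.le hft h3.mem).trans h1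
  intro x hx y hy
  obtain ⟨Ux, _, hGx, hDx⟩ := dd_desc hft hord hL hT hc hx.2
  obtain ⟨Uy, _, hGy, hDy⟩ := dd_desc hft hord hL hT hc hy.2
  constructor
  · obtain ⟨m, U, _, _, hG, hm, hmx, hmy, hall⟩ := q_meet hft hord hL hGx hDx hGy hDy
    refine ⟨m, ⟨ell_inW hft hord hL hG hm, hmx.trans hx.2⟩, hmx, hmy, ?_⟩
    intro z hz hzx hzy
    obtain ⟨Uz, _, hGz, hDz⟩ := dd_desc hft hord hL hT hc hz.2
    exact hall Uz z hGz hDz (desc hGx hDx hzx hDz) (desc hGy hDy hzy hDz)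
  · classical
    have hex : ∃ n : ℕ, ∃ (j : (Q.V → ℤ) → (Q.V → ℤ)) (U : Submodule ℚ (Q.V → ℚ)),
        absLe Q x j ∧ absLe Q y j ∧ absLe Q j (coxeter Q ord) ∧ NcG (qE Q) L U ∧ DD Q U j ∧
        Module.finrank ℚ U = n :=
      ⟨_, coxeter Q ord, ⊤, hx.2, hy.2, Relation.ReflTransGen.refl, hT, hc, rfl⟩
    obtain ⟨j, Uj, hxj, hyj, hjc, hGj, hDj, hfr⟩ := Nat.find_spec hex
    refine ⟨j, ⟨ell_inW hft hord hL hGj hDj, hjc⟩, hxj, hyj, ?_⟩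
    intro z hz hxz hyz
    obtain ⟨Uz, _, hGz, hDz⟩ := dd_desc hft hord hL hT hc hz.2
    obtain ⟨m, U, hUj, _, hG, hm, hmj, hmz, hall⟩ := q_meet hft hord hL hGj hDj hGz hDz
    have hxm := hall Ux x hGx hDx (desc hGj hDj hxj hDx) (desc hGz hDz hxz hDx)
    have hym := hall Uy y hGy hDy (desc hGj hDj hyj hDy) (desc hGz hDz hyz hDy)
    have hmin := Nat.find_min' hex ⟨m, U, hxm, hym, hmj.trans hjc, hG, hm, rfl⟩
    have heq := Submodule.eq_of_le_of_finrank_le hUj (by omega)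
    subst heq
    rw [hDj.unique hft hm]
    exact hmz

end Statement17
end NCPaper
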